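/- arXiv:1407.1604 — 7 statements merged into one kernel-verified Lean document; each statement's English description precedes it below -/
import Mathlib

section
/- Let k ≥ 1 and, for each i ∈ {1,…,k}, let (R^{(i)}_m)_{m≥1} be a sequence of real numbers. For n ≥ 1 define M^{(i)}_n = Σ_{π ∈ NC(n)} R^{(i)}_π. Then for every n ≥ 1 one has ∏_{i=1}^k M^{(i)}_n = Σ_{π ∈ NC(n)} Q_π, where the sequence (Q_m)_{m≥1} is defined by Q_m = Σ ∏_{i=1}^k R^{(i)}_{π_i}, the sum being over all k-tuples (π_1,…,π_k) ∈ NC(m)^k whose join in NC(m) equals 1_m. (In other words, if R^{(i)} is the free cumulant sequence of the moment sequence M^{(i)}, then Q is the free cumulant sequence of the product moment sequence (∏_i M^{(i)}_n)_n.) -/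
open Finset
open scoped Classical

/-- A finpartition of `{1,…,n}` (modeled as `Fin n`) is noncrossing if there are no
indices `i < j < k < l` with `i, k` in one block and `j, l` in a different block. -/
def IsNoncrossing {n : ℕ} (π : Finpartition (univ : Finset (Fin n))) : Prop :=
  ∀ p ∈ π.parts, ∀ q ∈ π.parts, ∀ i j k l : Fin n,
    i < j → j < k → k < l → i ∈ p → k ∈ p → j ∈ q → l ∈ q → p = q

/-- The join of a family of noncrossing partitions in the lattice `NC(n)` equals the
one-block partition `1_n` iff the only noncrossing partition coarser than every member
of the family is `1_n` (whose set of blocks is `{univ}`). -/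
def NCJoinEqOne {n : ℕ} {ι : Type*} (π : ι → Finpartition (univ : Finset (Fin n))) : Prop :=
  ∀ σ : Finpartition (univ : Finset (Fin n)),
    IsNoncrossing σ → (∀ i, π i ≤ σ) → σ.parts = {(univ : Finset (Fin n))}

namespace Finpartition

section Blocks

variable {α : Type*} [DecidableEq α] {s B c : Finset α}

lemma mem_restrict_iff (π : Finpartition s) (hB : B ≤ s) :
    c ∈ (π.restrict hB).parts ↔ c ≠ ∅ ∧ ∃ q ∈ π.parts, q ∩ B = c := by
  simp [restrict]

lemma mem_restrict_iff_of_le {π σ : Finpartition s} (h : π ≤ σ) (hB : B ∈ σ.parts) :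
    c ∈ (π.restrict (σ.le hB)).parts ↔ c ∈ π.parts ∧ c ⊆ B := by
  rw [mem_restrict_iff]
  constructor
  · rintro ⟨hne, q, hq, rfl⟩
    obtain ⟨C, hC, hqC⟩ := h hq
    obtain ⟨x, hx⟩ := Finset.nonempty_iff_ne_empty.2 hne
    rw [Finset.mem_inter] at hx
    obtain rfl := σ.eq_of_mem_parts hC hB (hqC hx.1) hx.2
    have hqB : q ∩ C = q := Finset.inter_eq_left.2 hqC
    exact ⟨by rwa [hqB], Finset.inter_subset_right⟩
  · rintro ⟨hc, hcB⟩
    exact ⟨π.ne_empty hc, c, hc, Finset.inter_eq_left.2 hcB⟩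

lemma bind_le (σ : Finpartition s) (Q : ∀ B ∈ σ.parts, Finpartition B) : σ.bind Q ≤ σ := by
  intro b hb
  obtain ⟨A, hA, hbA⟩ := mem_bind.1 hb
  exact ⟨A, hA, (Q A hA).le hbA⟩

lemma bind_restrict {π σ : Finpartition s} (h : π ≤ σ) :
    σ.bind (fun _ hB => π.restrict (σ.le hB)) = π := by
  ext c
  rw [mem_bind]
  constructor
  · rintro ⟨A, hA, hc⟩
    exact ((mem_restrict_iff_of_le h hA).1 hc).1
  · intro hc
    obtain ⟨A, hA, hcA⟩ := h hc
    exact ⟨A, hA, (mem_restrict_iff_of_le h hA).2 ⟨hc, hcA⟩⟩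

lemma restrict_bind (σ : Finpartition s) (Q : ∀ B ∈ σ.parts, Finpartition B)
    (hB : B ∈ σ.parts) : (σ.bind Q).restrict (σ.le hB) = Q B hB := by
  ext c
  rw [mem_restrict_iff_of_le (bind_le σ Q) hB, mem_bind]
  constructor
  · rintro ⟨⟨A, hA, hc⟩, hcB⟩
    obtain ⟨x, hx⟩ := (Q A hA).nonempty_of_mem_parts hc
    obtain rfl := σ.eq_of_mem_parts hA hB ((Q A hA).le hc hx) (hcB hx)
    exact hc
  · intro hc
    exact ⟨⟨B, hB, hc⟩, (Q B hB).le hc⟩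

lemma prod_bind {M : Type*} [CommMonoid M] (σ : Finpartition s)
    (Q : ∀ B ∈ σ.parts, Finpartition B) (f : Finset α → M) :
    ∏ p ∈ (σ.bind Q).parts, f p =
      ∏ B ∈ σ.parts.attach, ∏ p ∈ (Q B.1 B.2).parts, f p := by
  rw [bind_parts]
  apply Finset.prod_biUnion
  rintro ⟨b, hb⟩ - ⟨c, hc⟩ - hbc
  rw [Function.onFun, Finset.disjoint_left]
  intro d hdb hdc
  obtain ⟨x, hx⟩ := (Q b hb).nonempty_of_mem_parts hdb
  exact hbc (Subtype.ext (σ.eq_of_mem_parts hb hc ((Q b hb).le hdb hx) ((Q c hc).le hdc hx)))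

lemma restrict_mono {π τ : Finpartition s} (h : π ≤ τ) (hB : B ≤ s) :
    π.restrict hB ≤ τ.restrict hB := by
  intro c hc
  obtain ⟨hne, q, hq, rfl⟩ := (mem_restrict_iff π hB).1 hc
  obtain ⟨t, ht, hqt⟩ := h hq
  have hsub : q ∩ B ⊆ t ∩ B := Finset.inter_subset_inter_right hqt
  refine ⟨t ∩ B, (mem_restrict_iff τ hB).2 ⟨?_, t, ht, rfl⟩, hsub⟩
  rintro h0
  exact hne (Finset.subset_empty.1 (h0 ▸ hsub))

/-- Partitions are carried along an injection. -/
def mapEmbedding {β : Type*} [DecidableEq β] (f : α ↪ β) {t : Finset β} (hst : s.map f = t)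
    (π : Finpartition s) : Finpartition t :=
  ofExistsUnique (π.parts.map (Finset.mapEmbedding f).toEmbedding)
    (by
      subst hst
      intro p hp
      obtain ⟨q, hq, rfl⟩ := Finset.mem_map.1 hp
      exact Finset.map_subset_map.2 (π.le hq))
    (by
      subst hst
      intro a ha
      obtain ⟨x, hx, rfl⟩ := Finset.mem_map.1 ha
      obtain ⟨q, hq, hxq⟩ := π.exists_mem hx
      refine ⟨q.map f, ⟨Finset.mem_map_of_mem _ hq, Finset.mem_map_of_mem f hxq⟩, ?_⟩
      rintro _ ⟨hy, hxy⟩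
      obtain ⟨r, hr, rfl⟩ := Finset.mem_map.1 hy
      have hxr : x ∈ r := (Finset.mem_map' f).1 hxy
      rw [π.eq_of_mem_parts hr hq hxr hxq]
      rfl)
    (by
      simp only [Finset.mem_map, not_exists, not_and]
      intro q hq h
      exact π.ne_empty hq (Finset.map_eq_empty.1 h))

variable {β : Type*} [DecidableEq β] {f : α ↪ β} {t : Finset β} (hst : s.map f = t)

lemma parts_mapEmbedding (π : Finpartition s) :
    (π.mapEmbedding f hst).parts = π.parts.map (Finset.mapEmbedding f).toEmbedding := rfl

lemma mem_mapEmbedding {π : Finpartition s} {c : Finset β} :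
    c ∈ (π.mapEmbedding f hst).parts ↔ ∃ p ∈ π.parts, p.map f = c := by
  rw [parts_mapEmbedding, Finset.mem_map]
  rfl

lemma mapEmbedding_le_iff {π σ : Finpartition s} :
    π.mapEmbedding f hst ≤ σ.mapEmbedding f hst ↔ π ≤ σ := by
  constructor
  · intro h b hb
    obtain ⟨c, hc, hbc⟩ := h ((mem_mapEmbedding hst).2 ⟨b, hb, rfl⟩)
    obtain ⟨d, hd, rfl⟩ := (mem_mapEmbedding hst).1 hc
    exact ⟨d, hd, Finset.map_subset_map.1 hbc⟩
  · intro h b hb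
    obtain ⟨c, hc, rfl⟩ := (mem_mapEmbedding hst).1 hb
    obtain ⟨d, hd, hcd⟩ := h hc
    exact ⟨d.map f, (mem_mapEmbedding hst).2 ⟨d, hd, rfl⟩, Finset.map_subset_map.2 hcd⟩

lemma mapEmbedding_bijective :
    Function.Bijective (mapEmbedding f hst : Finpartition s → Finpartition t) := by
  refine ⟨fun π σ h => le_antisymm ((mapEmbedding_le_iff hst).1 h.le)
    ((mapEmbedding_le_iff hst).1 h.ge), fun τ => ?_⟩
  have hpre : ∀ p ∈ τ.parts, (s.filter (f · ∈ p)).map f = p := by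
    intro p hp
    ext y
    simp only [Finset.mem_map, Finset.mem_filter]
    constructor
    · rintro ⟨x, ⟨-, hx⟩, rfl⟩
      exact hx
    · intro hy
      have hyt := τ.le hp hy
      rw [← hst] at hyt
      obtain ⟨x, hx, rfl⟩ := Finset.mem_map.1 hyt
      exact ⟨x, ⟨hx, hy⟩, rfl⟩
  refine ⟨ofExistsUnique (τ.parts.image fun p => s.filter (f · ∈ p)) ?_ ?_ ?_, ?_⟩
  · intro p hp
    obtain ⟨q, -, rfl⟩ := Finset.mem_image.1 hp
    exact Finset.filter_subset _ _
  · intro a ha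
    obtain ⟨p, hp, hap⟩ := τ.exists_mem (hst ▸ Finset.mem_map_of_mem f ha)
    refine ⟨s.filter (f · ∈ p), ⟨Finset.mem_image_of_mem _ hp, by simp [ha, hap]⟩, ?_⟩
    rintro _ ⟨hy, hay⟩
    obtain ⟨q, hq, rfl⟩ := Finset.mem_image.1 hy
    rw [τ.eq_of_mem_parts hq hp (Finset.mem_filter.1 hay).2 hap]
  · intro h
    obtain ⟨q, hq, h0⟩ := Finset.mem_image.1 h
    have hq' := hpre q hq
    rw [h0, Finset.map_empty] at hq'
    exact τ.empty_notMem_parts (hq' ▸ hq)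
  · ext c
    rw [mem_mapEmbedding]
    simp only [ofExistsUnique, Finset.mem_image, exists_exists_and_eq_and]
    constructor
    · rintro ⟨p, hp, rfl⟩
      rwa [hpre p hp]
    · intro hc
      exact ⟨c, hc, hpre c hc⟩

end Blocks

section Noncrossing

variable {m n k : ℕ} {s : Finset (Fin n)}

/-- A partition of a set of indices has no crossing pair of blocks. -/
def Noncrossing (π : Finpartition s) : Prop :=
  ∀ p ∈ π.parts, ∀ q ∈ π.parts, ∀ i j k l : Fin n,
    i < j → j < k → k < l → i ∈ p → k ∈ p → j ∈ q → l ∈ q → p = q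

/-- The only noncrossing partition coarser than every member of the family is `{s}`. -/
def NoncrossingJoinEqTop {ι : Type*} (π : ι → Finpartition s) : Prop :=
  ∀ σ : Finpartition s, σ.Noncrossing → (∀ i, π i ≤ σ) → σ.parts = {s}

/-- `σ` is the least noncrossing partition coarser than every member of the family `π`. -/
def IsNoncrossingJoin {ι : Type*} (π : ι → Finpartition s) (σ : Finpartition s) : Prop :=
  σ.Noncrossing ∧ (∀ i, π i ≤ σ) ∧ ∀ τ : Finpartition s, τ.Noncrossing → (∀ i, π i ≤ τ) → σ ≤ τ

lemma Noncrossing.inf {π σ : Finpartition s} (hπ : π.Noncrossing) (hσ : σ.Noncrossing) :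
    (π ⊓ σ).Noncrossing := by
  intro p hp q hq i j k l hij hjk hkl hi hk hj hl
  simp only [parts_inf, Finset.mem_erase, Finset.mem_image, Finset.mem_product, Prod.exists] at hp hq
  obtain ⟨-, p₁, p₂, ⟨hp₁, hp₂⟩, rfl⟩ := hp
  obtain ⟨-, q₁, q₂, ⟨hq₁, hq₂⟩, rfl⟩ := hq
  simp only [Finset.inf_eq_inter, Finset.mem_inter] at hi hj hk hl
  rw [hπ p₁ hp₁ q₁ hq₁ i j k l hij hjk hkl hi.1 hk.1 hj.1 hl.1,
    hσ p₂ hp₂ q₂ hq₂ i j k l hij hjk hkl hi.2 hk.2 hj.2 hl.2]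

lemma noncrossing_top : (⊤ : Finpartition s).Noncrossing := by
  intro p hp q hq i j k l _ _ _ _ _ _ _
  rw [Finset.mem_singleton.1 (parts_top_subset s hp), Finset.mem_singleton.1 (parts_top_subset s hq)]

lemma Noncrossing.restrict {π : Finpartition s} (hπ : π.Noncrossing) {B : Finset (Fin n)}
    (hB : B ≤ s) : (π.restrict hB).Noncrossing := by
  intro p hp q hq i j k l hij hjk hkl hi hk hj hl
  obtain ⟨-, p, hp', rfl⟩ := (mem_restrict_iff π hB).1 hp
  obtain ⟨-, q, hq', rfl⟩ := (mem_restrict_iff π hB).1 hq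
  simp only [Finset.mem_inter] at hi hj hk hl
  rw [hπ p hp' q hq' i j k l hij hjk hkl hi.1 hk.1 hj.1 hl.1]

lemma Noncrossing.bind {σ : Finpartition s} (hσ : σ.Noncrossing)
    {Q : ∀ B ∈ σ.parts, Finpartition B} (hQ : ∀ B hB, (Q B hB).Noncrossing) :
    (σ.bind Q).Noncrossing := by
  intro p hp q hq i j k l hij hjk hkl hi hk hj hl
  obtain ⟨A, hA, hp⟩ := mem_bind.1 hp
  obtain ⟨B, hB, hq⟩ := mem_bind.1 hq
  have hpA := (Q A hA).le hp
  have hqB := (Q B hB).le hq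
  obtain rfl := hσ A hA B hB i j k l hij hjk hkl (hpA hi) (hpA hk) (hqB hj) (hqB hl)
  exact hQ A hA p hp q hq i j k l hij hjk hkl hi hk hj hl

lemma exists_isNoncrossingJoin {ι : Type*} (π : ι → Finpartition s) :
    ∃ σ, IsNoncrossingJoin π σ := by
  let U : Finset (Finpartition s) := univ.filter fun τ => τ.Noncrossing ∧ ∀ i, π i ≤ τ
  refine ⟨U.inf id, ?_, ?_, ?_⟩
  · exact Finset.inf_induction noncrossing_top (fun _ h₁ _ h₂ => h₁.inf h₂)
      fun τ hτ => (Finset.mem_filter.1 hτ).2.1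
  · exact fun i => Finset.le_inf fun τ hτ => (Finset.mem_filter.1 hτ).2.2 i
  · exact fun τ h₁ h₂ => Finset.inf_le (f := id) (Finset.mem_filter.2 ⟨Finset.mem_univ _, h₁, h₂⟩)

lemma IsNoncrossingJoin.unique {ι : Type*} {π : ι → Finpartition s} {σ τ : Finpartition s}
    (hσ : IsNoncrossingJoin π σ) (hτ : IsNoncrossingJoin π τ) : σ = τ :=
  le_antisymm (hσ.2.2 τ hτ.1 hτ.2.1) (hτ.2.2 σ hσ.1 hσ.2.1)

lemma IsNoncrossingJoin.restrict {ι : Type*} {π : ι → Finpartition s} {σ : Finpartition s}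
    (h : IsNoncrossingJoin π σ) {B : Finset (Fin n)} (hB : B ∈ σ.parts) :
    NoncrossingJoinEqTop fun i => (π i).restrict (σ.le hB) := by
  intro τ hτ hle
  let Q : ∀ C ∈ σ.parts, Finpartition C := fun C hC =>
    if hCB : C = B then τ.copy hCB.symm else indiscrete (σ.ne_bot hC)
  have hQB : Q B hB = τ := by simp [Q]; rfl
  have hQ : ∀ C hC, (Q C hC).Noncrossing := by
    intro C hC
    by_cases hCB : C = B
    · subst hCB
      rwa [hQB]
    · simp only [Q, dif_neg hCB]
      intro p hp q hq _ _ _ _ _ _ _ _ _ _ _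
      simp only [indiscrete_parts, Finset.mem_singleton] at hp hq
      rw [hp, hq]
  have hle' : ∀ i, π i ≤ σ.bind Q := by
    intro i b hb
    obtain ⟨C, hC, hbC⟩ := h.2.1 i hb
    by_cases hCB : C = B
    · subst hCB
      obtain ⟨d, hd, hbd⟩ := hle i ((mem_restrict_iff_of_le (h.2.1 i) hC).2 ⟨hb, hbC⟩)
      exact ⟨d, mem_bind.2 ⟨C, hC, hQB.symm ▸ hd⟩, hbd⟩
    · refine ⟨C, mem_bind.2 ⟨C, hC, ?_⟩, hbC⟩
      simp [Q, hCB]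
  obtain ⟨d, hd, hBd⟩ := h.2.2 _ (h.1.bind hQ) hle' hB
  obtain ⟨x, hx⟩ := σ.nonempty_of_mem_parts hB
  obtain ⟨C, hC, hdC⟩ := mem_bind.1 hd
  obtain rfl := σ.eq_of_mem_parts hC hB ((Q C hC).le hdC (hBd hx)) hx
  rw [hQB] at hdC
  obtain rfl : d = C := (τ.le hdC).antisymm hBd
  refine Finset.eq_singleton_iff_unique_mem.2 ⟨hdC, fun e he => ?_⟩
  obtain ⟨y, hy⟩ := τ.nonempty_of_mem_parts he
  exact τ.eq_of_mem_parts he hdC hy (τ.le he hy)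

lemma isNoncrossingJoin_bind {ι : Type*} {σ : Finpartition s} (hσ : σ.Noncrossing)
    {Q : ∀ B ∈ σ.parts, ι → Finpartition B} (hQ : ∀ B hB, NoncrossingJoinEqTop (Q B hB)) :
    IsNoncrossingJoin (fun i => σ.bind fun B hB => Q B hB i) σ := by
  refine ⟨hσ, fun i => bind_le _ _, fun τ hτ hle B hB => ?_⟩
  have hτB := hQ B hB (τ.restrict (σ.le hB)) (hτ.restrict _) fun i => by
    have h := restrict_mono (hle i) (σ.le hB)
    rwa [restrict_bind] at h
  have hmem : B ∈ (τ.restrict (σ.le hB)).parts := by simp [hτB]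
  obtain ⟨-, t, ht, htB⟩ := (mem_restrict_iff τ _).1 hmem
  exact ⟨t, ht, Finset.inter_eq_right.1 htB⟩

lemma sum_isNoncrossingJoin {K : Type*} [CommSemiring K] (w : Fin k → Finset (Fin n) → K)
    {σ : Finpartition s} (hσ : σ.Noncrossing) :
    ∑ π ∈ (univ : Finset (Fin k → Finpartition s)).filter
        (fun π => (∀ i, (π i).Noncrossing) ∧ IsNoncrossingJoin π σ),
      ∏ i, ∏ p ∈ (π i).parts, w i p =
    ∏ B ∈ σ.parts, ∑ π ∈ (univ : Finset (Fin k → Finpartition B)).filter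
        (fun π => (∀ i, (π i).Noncrossing) ∧ NoncrossingJoinEqTop π),
      ∏ i, ∏ p ∈ (π i).parts, w i p := by
  rw [Finset.prod_sum]
  refine Finset.sum_bij' (fun π _ B hB i => (π i).restrict (σ.le hB))
    (fun Q _ i => σ.bind fun B hB => Q B hB i) ?_ ?_ ?_ ?_ ?_
  · intro π hπ
    obtain ⟨-, h₁, h₂⟩ := Finset.mem_filter.1 hπ
    exact Finset.mem_pi.2 fun B hB => Finset.mem_filter.2
      ⟨Finset.mem_univ _, fun i => (h₁ i).restrict _, h₂.restrict hB⟩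
  · intro Q hQ
    have h := fun B hB => (Finset.mem_filter.1 (Finset.mem_pi.1 hQ B hB)).2
    exact Finset.mem_filter.2 ⟨Finset.mem_univ _, fun i => hσ.bind fun B hB => (h B hB).1 i,
      isNoncrossingJoin_bind hσ fun B hB => (h B hB).2⟩
  · intro π hπ
    obtain ⟨-, -, h₂⟩ := Finset.mem_filter.1 hπ
    exact funext fun i => bind_restrict (h₂.2.1 i)
  · intro Q hQ
    exact funext fun B => funext fun hB => funext fun i => restrict_bind σ _ hB
  · intro π hπ
    obtain ⟨-, -, h₂⟩ := Finset.mem_filter.1 hπ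
    rw [Finset.prod_comm]
    refine Finset.prod_congr rfl fun i _ => ?_
    conv_lhs => rw [← bind_restrict (h₂.2.1 i)]
    exact prod_bind _ _ _

lemma noncrossing_mapEmbedding {s : Finset (Fin m)} {t : Finset (Fin n)} (f : Fin m ↪o Fin n)
    (hst : s.map f.toEmbedding = t) (π : Finpartition s) :
    (π.mapEmbedding f.toEmbedding hst).Noncrossing ↔ π.Noncrossing := by
  constructor
  · intro h p hp q hq i j k l hij hjk hkl hi hk hj hl
    exact Finset.map_injective f.toEmbedding <|
      h _ ((mem_mapEmbedding hst).2 ⟨p, hp, rfl⟩) _ ((mem_mapEmbedding hst).2 ⟨q, hq, rfl⟩)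
        (f i) (f j) (f k) (f l) (f.lt_iff_lt.2 hij) (f.lt_iff_lt.2 hjk) (f.lt_iff_lt.2 hkl)
        (Finset.mem_map_of_mem _ hi) (Finset.mem_map_of_mem _ hk)
        (Finset.mem_map_of_mem _ hj) (Finset.mem_map_of_mem _ hl)
  · intro h p hp q hq i j k l hij hjk hkl hi hk hj hl
    obtain ⟨p, hp', rfl⟩ := (mem_mapEmbedding hst).1 hp
    obtain ⟨q, hq', rfl⟩ := (mem_mapEmbedding hst).1 hq
    obtain ⟨i, hi', rfl⟩ := Finset.mem_map.1 hi
    obtain ⟨j, hj', rfl⟩ := Finset.mem_map.1 hj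
    obtain ⟨k, hk', rfl⟩ := Finset.mem_map.1 hk
    obtain ⟨l, hl', rfl⟩ := Finset.mem_map.1 hl
    rw [h p hp' q hq' i j k l (f.lt_iff_lt.1 hij) (f.lt_iff_lt.1 hjk) (f.lt_iff_lt.1 hkl)
      hi' hk' hj' hl']

lemma noncrossingJoinEqTop_mapEmbedding {ι : Type*} {s : Finset (Fin m)} {t : Finset (Fin n)}
    (f : Fin m ↪o Fin n) (hst : s.map f.toEmbedding = t) (π : ι → Finpartition s) :
    NoncrossingJoinEqTop (fun i => (π i).mapEmbedding f.toEmbedding hst) ↔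
      NoncrossingJoinEqTop π := by
  unfold NoncrossingJoinEqTop
  rw [(mapEmbedding_bijective hst).surjective.forall]
  refine forall_congr' fun σ => ?_
  simp only [noncrossing_mapEmbedding, mapEmbedding_le_iff]
  refine imp_congr_right fun _ => imp_congr_right fun _ => ?_
  have hs : ({t} : Finset (Finset (Fin n))) =
      ({s} : Finset (Finset (Fin m))).map (Finset.mapEmbedding f.toEmbedding).toEmbedding := by
    subst hst
    rfl
  rw [parts_mapEmbedding, hs, Finset.map_inj]

lemma sum_noncrossingJoinEqTop_eq {K : Type*} [CommSemiring K] (R : Fin k → ℕ → K)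
    (B : Finset (Fin n)) :
    ∑ π ∈ (univ : Finset (Fin k → Finpartition (univ : Finset (Fin B.card)))).filter
        (fun π => (∀ i, (π i).Noncrossing) ∧ NoncrossingJoinEqTop π),
      ∏ i, ∏ p ∈ (π i).parts, R i p.card =
    ∑ π ∈ (univ : Finset (Fin k → Finpartition B)).filter
        (fun π => (∀ i, (π i).Noncrossing) ∧ NoncrossingJoinEqTop π),
      ∏ i, ∏ p ∈ (π i).parts, R i p.card := by
  have hst : univ.map (B.orderEmbOfFin rfl).toEmbedding = B := Finset.map_orderEmbOfFin_univ B rfl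
  let e := Equiv.piCongrRight fun _ : Fin k => Equiv.ofBijective _ (mapEmbedding_bijective hst)
  refine Finset.sum_equiv e (fun π => ?_) fun π _ => ?_
  · simp only [Finset.mem_filter, Finset.mem_univ, true_and]
    exact and_congr (forall_congr' fun i => (noncrossing_mapEmbedding _ hst _).symm)
      (noncrossingJoinEqTop_mapEmbedding _ hst π).symm
  · refine Finset.prod_congr rfl fun i _ => ?_
    change _ = ∏ p ∈ ((π i).mapEmbedding _ hst).parts, R i p.card
    rw [parts_mapEmbedding, Finset.prod_map]
    simp

end Noncrossing

end Finpartition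

/-- **Free cumulants of a product.**  If, for each `i`, `(R i m)_{m ≥ 1}` is the free cumulant
sequence of the sequence of moments `(M i n)_{n ≥ 1}` (i.e. `M i n = ∑_{π ∈ NC(n)} ∏_{p ∈ π} R i |p|`),
then the free cumulant sequence of the product moment sequence `(∏ i, M i n)_{n ≥ 1}` is the
sequence `Q` given by `Q m = ∑_{π₁ ∨ ⋯ ∨ π_k = 1_m in NC(m)} ∏ i, R i (π i)`. -/
theorem freeCumulants_of_product (k : ℕ) (hk : 1 ≤ k) (R : Fin k → ℕ → ℝ) (M : Fin k → ℕ → ℝ)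
    (hM : ∀ i : Fin k, ∀ n : ℕ, 1 ≤ n →
      M i n = ∑ π ∈ (univ : Finset (Finpartition (univ : Finset (Fin n)))).filter
          IsNoncrossing, ∏ p ∈ π.parts, R i p.card)
    (Q : ℕ → ℝ)
    (hQ : ∀ m : ℕ, 1 ≤ m →
      Q m = ∑ π ∈ (univ : Finset (Fin k → Finpartition (univ : Finset (Fin m)))).filter
          (fun π => (∀ i, IsNoncrossing (π i)) ∧ NCJoinEqOne π),
        ∏ i, ∏ p ∈ (π i).parts, R i p.card)
    (n : ℕ) (hn : 1 ≤ n) :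
    (∏ i, M i n) = ∑ π ∈ (univ : Finset (Finpartition (univ : Finset (Fin n)))).filter
        IsNoncrossing, ∏ p ∈ π.parts, Q p.card := by
  have hprod : (∏ i, M i n) = ∑ π ∈ Fintype.piFinset (fun _ : Fin k =>
      (univ : Finset (Finpartition (univ : Finset (Fin n)))).filter IsNoncrossing),
      ∏ i, ∏ p ∈ (π i).parts, R i p.card := by
    rw [Finset.prod_congr rfl fun i _ => hM i n hn]
    exact Finset.prod_univ_sum _
      fun i (π : Finpartition (univ : Finset (Fin n))) => ∏ p ∈ π.parts, R i p.card
  choose join hjoin using fun π : Fin k → Finpartition (univ : Finset (Fin n)) =>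
    Finpartition.exists_isNoncrossingJoin π
  rw [hprod, ← Finset.sum_fiberwise_of_maps_to (g := join) (t := univ.filter IsNoncrossing)
    fun π _ => Finset.mem_filter.2 ⟨Finset.mem_univ _, (hjoin π).1⟩]
  refine Finset.sum_congr rfl fun σ hσ => ?_
  have hσ' : σ.Noncrossing := (Finset.mem_filter.1 hσ).2
  have hfiber := Finpartition.sum_isNoncrossingJoin (fun i p => R i p.card) hσ'
  calc _ = _ := Finset.sum_congr ?_ fun _ _ => rfl
    _ = _ := hfiber
    _ = _ := Finset.prod_congr rfl fun B hB => ?_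
  · ext π
    simp only [Finset.mem_filter, Fintype.mem_piFinset, Finset.mem_univ, true_and]
    refine and_congr Iff.rfl ⟨?_, fun h => (hjoin π).unique h⟩
    rintro rfl
    exact hjoin π
  · rw [hQ B.card (σ.nonempty_of_mem_parts hB).card_pos]
    exact (Finpartition.sum_noncrossingJoinEqTop_eq R B).symm
end

section
/- Fix k ≥ 1, and for m ≥ 1 let Q^{(k)}_m be the number of k-tuples (π_1,…,π_k) ∈ NC(m)^k whose join in NC(m) equals 1_m. Then for every n ≥ 1, Cat_n^k = Σ_{π ∈ NC(n)} Q^{(k)}_π; that is, (Q^{(k)}_m)_{m≥1} is the free cumulant sequence of the moment sequence (Cat_n^k)_{n≥1} (the moments of X_1²⋯X_k² for independent standard semicircular variables X_1,…,X_k). -/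
open Finset
open scoped Classical

/-- `Q k m` is the number of `k`-tuples `(π₁,…,π_k)` of noncrossing partitions
of `{1,…,m}` whose join in `NC(m)` is the one-block partition `1_m`. -/
noncomputable def ncJoinCount (k m : ℕ) : ℕ :=
  ((univ : Finset (Fin k → Finpartition (univ : Finset (Fin m)))).filter
    (fun σ => (∀ i, IsNoncrossing (σ i)) ∧ NCJoinEqOne σ)).card

namespace Setoid

variable {α β ι : Type*} [LinearOrder α] [LinearOrder β]

/-- An equivalence relation on a linear order is noncrossing if no two distinct classes cross. -/
def Noncrossing (s : Setoid α) : Prop :=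
  ∀ ⦃a b c d : α⦄, a < b → b < c → c < d → s a c → s b d → s a b

/-- `s` is the join of the family `σ` in the lattice of noncrossing equivalence relations. -/
def IsNCJoin (σ : ι → Setoid α) (s : Setoid α) : Prop :=
  s.Noncrossing ∧ (∀ i, σ i ≤ s) ∧ ∀ t : Setoid α, t.Noncrossing → (∀ i, σ i ≤ t) → s ≤ t

lemma Noncrossing.comap {s : Setoid β} (hs : s.Noncrossing) {f : α → β} (hf : StrictMono f) :
    (s.comap f).Noncrossing :=
  fun _ _ _ _ hab hbc hcd hac hbd => hs (hf hab) (hf hbc) (hf hcd) hac hbd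

lemma noncrossing_sInf {S : Set (Setoid α)} (hS : ∀ s ∈ S, s.Noncrossing) :
    (sInf S).Noncrossing :=
  fun _ _ _ _ hab hbc hcd hac hbd s hs => hS s hs hab hbc hcd (hac s hs) (hbd s hs)

lemma exists_isNCJoin (σ : ι → Setoid α) : ∃ s, IsNCJoin σ s :=
  ⟨sInf {t | t.Noncrossing ∧ ∀ i, σ i ≤ t}, noncrossing_sInf fun _ ht => ht.1,
    fun i => le_sInf fun _ ht => ht.2 i, fun _ ht hσ => sInf_le ⟨ht, hσ⟩⟩

lemma IsNCJoin.unique {σ : ι → Setoid α} {s t : Setoid α} (hs : IsNCJoin σ s)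
    (ht : IsNCJoin σ t) : s = t :=
  le_antisymm (hs.2.2 t ht.1 ht.2.1) (ht.2.2 s hs.1 hs.2.1)

lemma noncrossing_top : (⊤ : Setoid α).Noncrossing := fun _ _ _ _ _ _ _ _ _ => trivial

/-- Pulling back along an order isomorphism. -/
def comapOrderIso (e : α ≃o β) : Setoid β ≃ Setoid α where
  toFun s := s.comap e
  invFun s := s.comap e.symm
  left_inv s := by
    ext x y
    simp only [Setoid.comap_rel, OrderIso.apply_symm_apply]
  right_inv s := by
    ext x y
    simp only [Setoid.comap_rel, OrderIso.symm_apply_apply]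

lemma comapOrderIso_le_iff (e : α ≃o β) {s t : Setoid β} :
    comapOrderIso e s ≤ comapOrderIso e t ↔ s ≤ t := by
  refine ⟨fun h x y hxy => ?_, fun h x y hxy => h hxy⟩
  have key : ∀ r : Setoid β, comapOrderIso e r (e.symm x) (e.symm y) ↔ r x y := fun r => by
    rw [comapOrderIso, Equiv.coe_fn_mk, Setoid.comap_rel, e.apply_symm_apply, e.apply_symm_apply]
  exact (key t).1 (h ((key s).2 hxy))

lemma noncrossing_comapOrderIso_iff (e : α ≃o β) {s : Setoid β} :
    (comapOrderIso e s).Noncrossing ↔ s.Noncrossing := by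
  refine ⟨fun h => ?_, fun h => h.comap e.strictMono⟩
  have := h.comap e.symm.strictMono
  rwa [← (comapOrderIso e).left_inv s]

lemma isNCJoin_comapOrderIso_iff (e : α ≃o β) {σ : ι → Setoid β} {s : Setoid β} :
    IsNCJoin (fun i => comapOrderIso e (σ i)) (comapOrderIso e s) ↔ IsNCJoin σ s := by
  simp only [IsNCJoin, (comapOrderIso e).surjective.forall, noncrossing_comapOrderIso_iff,
    comapOrderIso_le_iff]

end Setoid

open Setoid

/-- The noncrossing equivalence relations on a linear order. -/
abbrev NCSetoid (α : Type*) [LinearOrder α] := {s : Setoid α // s.Noncrossing}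

/-- The tuples of noncrossing equivalence relations whose noncrossing join is `s`. -/
abbrev NCJoinTuple (ι : Type*) {α : Type*} [LinearOrder α] (s : Setoid α) :=
  {σ : ι → Setoid α // (∀ i, (σ i).Noncrossing) ∧ IsNCJoin σ s}

section Extend

variable {α : Type*}

/-- The equivalence relation on `α` extending one on a subset by singletons. -/
def Setoid.extendSubtype (S : Set α) (s : Setoid S) : Setoid α where
  r x y := x = y ∨ ∃ (hx : x ∈ S) (hy : y ∈ S), s ⟨x, hx⟩ ⟨y, hy⟩
  iseqv :=
    { refl := fun x => Or.inl rfl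
      symm := by
        rintro x y (rfl | ⟨hx, hy, h⟩)
        · exact Or.inl rfl
        · exact Or.inr ⟨hy, hx, s.symm' h⟩
      trans := by
        rintro x y z (rfl | ⟨hx, hy, h⟩) (rfl | ⟨hy', hz, h'⟩)
        · exact Or.inl rfl
        · exact Or.inr ⟨hy', hz, h'⟩
        · exact Or.inr ⟨hx, hy, h⟩
        · exact Or.inr ⟨hx, hz, s.trans' h h'⟩ }

lemma Setoid.extendSubtype_coe {S : Set α} {s : Setoid S} {x y : S} :
    s.extendSubtype S x y ↔ s x y := by
  refine ⟨?_, fun h => Or.inr ⟨x.2, y.2, h⟩⟩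
  rintro (h | ⟨_, _, h⟩)
  · rw [Subtype.ext h]
  · exact h

instance [Finite α] : Finite (Setoid α) :=
  Finite.of_injective (fun s : Setoid α => (⇑s : α → α → Prop)) fun _ _ h =>
    Setoid.ext fun a b => iff_of_eq (congrFun (congrFun h a) b)

end Extend

section Catalan

variable {α β : Type*} [LinearOrder α] [LinearOrder β]

lemma card_ncSetoid_congr (e : α ≃o β) : Nat.card (NCSetoid α) = Nat.card (NCSetoid β) :=
  Nat.card_congr ((comapOrderIso e).subtypeEquiv fun _ =>
    (noncrossing_comapOrderIso_iff e).symm).symm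

/-- The noncrossing equivalence relations for which `m` is the greatest element equivalent to
the least element. -/
abbrev NCSetoidWithLast [OrderBot α] (m : α) :=
  {s : Setoid α // s.Noncrossing ∧ s ⊥ m ∧ ∀ x, m < x → ¬ s ⊥ x}

/-- Restriction to the elements below and above the greatest element of the bottom class. -/
def NCSetoidWithLast.split [OrderBot α] (m : α) (s : NCSetoidWithLast m) :
    NCSetoid (Set.Iio m) × NCSetoid (Set.Ioi m) :=
  (⟨s.1.comap Subtype.val, s.2.1.comap (Subtype.strictMono_coe _)⟩,
    ⟨s.1.comap Subtype.val, s.2.1.comap (Subtype.strictMono_coe _)⟩)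

lemma NCSetoidWithLast.split_injective [OrderBot α] (m : α) :
    Function.Injective (NCSetoidWithLast.split m) := by
  have not_rel_of_lt : ∀ s : NCSetoidWithLast m, ∀ x y, x ≤ m → m < y → ¬ s.1 x y := by
    rintro ⟨s, hs, hm, hlast⟩ x y hx hy hxy
    rcases hx.lt_or_eq with hx | rfl
    · rcases eq_bot_or_bot_lt x with rfl | h0
      · exact hlast y hy hxy
      · exact hlast y hy (s.trans' (hs h0 hx hy hm hxy) hxy)
    · exact hlast y hy (s.trans' hm hxy)
  have key : ∀ s t : NCSetoidWithLast m, split m s = split m t → s.1 ≤ t.1 := by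
    intro s t h x y hxy
    have hlow : ∀ x y, x < m → y < m → s.1 x y → t.1 x y := by
      intro x y hx hy hxy
      have h1 := congrArg (fun u => u.1.1 ⟨x, hx⟩ ⟨y, hy⟩) h
      exact (iff_of_eq h1).1 hxy
    have hhigh : ∀ x y, m < x → m < y → s.1 x y → t.1 x y := by
      intro x y hx hy hxy
      have h1 := congrArg (fun u => u.2.1 ⟨x, hx⟩ ⟨y, hy⟩) h
      exact (iff_of_eq h1).1 hxy
    have hmid : ∀ x, x < m → s.1 x m → t.1 x m := fun x hx hxm =>
      t.1.trans' (hlow x ⊥ hx (bot_le.trans_lt hx) (s.1.trans' hxm (s.1.symm' s.2.2.1))) t.2.2.1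
    rcases lt_trichotomy x m with hx | hx | hx <;> rcases lt_trichotomy y m with hy | hy | hy
    · exact hlow x y hx hy hxy
    · subst hy
      exact hmid x hx hxy
    · exact (not_rel_of_lt s x y hx.le hy hxy).elim
    · subst hx
      exact t.1.symm' (hmid y hy (s.1.symm' hxy))
    · exact hx.trans hy.symm ▸ t.1.refl' _
    · exact (not_rel_of_lt s x y hx.le hy hxy).elim
    · exact (not_rel_of_lt s y x hy.le hx (s.1.symm' hxy)).elim
    · exact (not_rel_of_lt s y x hy.le hx (s.1.symm' hxy)).elim
    · exact hhigh x y hx hy hxy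
  exact fun s t h => Subtype.ext (le_antisymm (key s t h) (key t s h.symm))

lemma Setoid.Noncrossing.extendSubtype {S : Set α} {s : Setoid S} (hs : s.Noncrossing) :
    (s.extendSubtype S).Noncrossing := by
  rintro a b c d hab hbc hcd (hac | ⟨ha, hc, hac⟩) (hbd | ⟨hb, hd, hbd⟩)
  · exact absurd hac (hab.trans hbc).ne
  · exact absurd hac (hab.trans hbc).ne
  · exact absurd hbd (hbc.trans hcd).ne
  · exact Or.inr ⟨ha, hb, hs (a := ⟨a, ha⟩) (b := ⟨b, hb⟩) (c := ⟨c, hc⟩) (d := ⟨d, hd⟩)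
      hab hbc hcd hac hbd⟩

lemma NCSetoidWithLast.split_surjective [OrderBot α] (m : α) :
    Function.Surjective (NCSetoidWithLast.split m) := by
  rintro ⟨⟨a, ha⟩, ⟨b, hb⟩⟩
  obtain ⟨A, hA⟩ : ∃ A, A = a.extendSubtype _ := ⟨_, rfl⟩
  obtain ⟨B, hB⟩ : ∃ B, B = b.extendSubtype _ := ⟨_, rfl⟩
  have hA1 : ∀ x y, A x y → x = y ∨ (x < m ∧ y < m) := by
    rintro x y h
    rw [hA] at h
    obtain h | ⟨hx, hy, -⟩ := h
    exacts [Or.inl h, Or.inr ⟨hx, hy⟩]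
  have hB1 : ∀ x y, B x y → x = y ∨ (m < x ∧ m < y) := by
    rintro x y h
    rw [hB] at h
    obtain h | ⟨hx, hy, -⟩ := h
    exacts [Or.inl h, Or.inr ⟨hx, hy⟩]
  have hAnc : A.Noncrossing := hA ▸ ha.extendSubtype
  have hBnc : B.Noncrossing := hB ▸ hb.extendSubtype
  let f : α → α := fun x => if x = m then ⊥ else x
  have hfm : f m = ⊥ := if_pos rfl
  have hf : ∀ x, x ≠ m → f x = x := fun x hx => if_neg hx
  have hf0 : f ⊥ = ⊥ := by by_cases h : (⊥ : α) = m <;> simp [f, h]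
  let s : Setoid α :=
    { r := fun x y => A (f x) (f y) ∨ B (f x) (f y)
      iseqv :=
        { refl := fun x => Or.inl (A.refl' _)
          symm := fun h => h.imp A.symm' B.symm'
          trans := by
            intro x y z h h'
            generalize f x = x at *
            generalize f y = y at *
            generalize f z = z at *
            rcases h with h | h <;> rcases h' with h' | h'
            · exact Or.inl (A.trans' h h')
            · rcases hA1 _ _ h with rfl | h1
              · exact Or.inr h'
              · rcases hB1 _ _ h' with rfl | h2
                · exact Or.inl h
                · exact absurd (h1.2.trans h2.1) (lt_irrefl _)
            · rcases hB1 _ _ h with rfl | h1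
              · exact Or.inl h'
              · rcases hA1 _ _ h' with rfl | h2
                · exact Or.inr h
                · exact absurd (h1.2.trans h2.1) (lt_irrefl _)
            · exact Or.inr (B.trans' h h') } }
  have hs : ∀ x y, s x y ↔ A (f x) (f y) ∨ B (f x) (f y) := fun _ _ => Iff.rfl
  have slow : ∀ x y, x < m → (s x y ↔ A x (f y)) := by
    intro x y hx
    rw [hs, hf x hx.ne]
    refine ⟨?_, Or.inl⟩
    rintro (h | h)
    · exact h
    · rcases hB1 _ _ h with h | h
      · exact h ▸ A.refl' _
      · exact absurd (hx.trans h.1) (lt_irrefl _)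
  have shigh : ∀ x y, m < x → m < y → (s x y ↔ B x y) := by
    intro x y hx hy
    rw [hs, hf x hx.ne', hf y hy.ne']
    refine ⟨?_, Or.inr⟩
    rintro (h | h)
    · rcases hA1 _ _ h with h | h
      · exact h ▸ B.refl' _
      · exact absurd (hx.trans h.1) (lt_irrefl _)
    · exact h
  have scross : ∀ x y, x ≤ m → m < y → ¬ s x y := by
    intro x y hx hy h
    rw [hs, hf y hy.ne'] at h
    have hfx : f x ≤ m := by
      by_cases h : x = m
      · rw [h, hfm]; exact bot_le
      · rwa [hf x h]
    rcases h with h | h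
    · rcases hA1 _ _ h with h | h
      · exact absurd (h ▸ hfx) hy.not_ge
      · exact absurd h.2 hy.not_gt
    · rcases hB1 _ _ h with h | h
      · exact absurd (h ▸ hfx) hy.not_ge
      · exact absurd h.1 hfx.not_gt
  refine ⟨⟨s, ?_, ?_, ?_⟩, ?_⟩
  · intro w x y z hwx hxy hyz hwy hxz
    rcases lt_or_ge m w with hw | hw
    · have hx := hw.trans hwx
      have hy := hx.trans hxy
      rw [shigh _ _ hw hy] at hwy
      rw [shigh _ _ hx (hy.trans hyz)] at hxz
      rw [shigh _ _ hw hx]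
      exact hBnc hwx hxy hyz hwy hxz
    · have hy : y ≤ m := not_lt.1 fun hy => scross w y hw hy hwy
      have hx : x < m := hxy.trans_le hy
      have hz : z ≤ m := not_lt.1 fun hz => scross x z hx.le hz hxz
      have hy : y < m := hyz.trans_le hz
      have hw : w < m := hwx.trans hx
      rw [slow _ _ hw, hf _ hy.ne] at hwy
      rw [slow _ _ hx] at hxz
      rw [slow _ _ hw, hf _ hx.ne]
      rcases hz.lt_or_eq with hz | rfl
      · rw [hf _ hz.ne] at hxz
        exact hAnc hwx hxy hyz hwy hxz
      · rw [hfm] at hxz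
        rcases eq_bot_or_bot_lt w with rfl | hw0
        · exact A.symm' hxz
        · exact A.trans' (A.symm' (hAnc hw0 hwx hxy (A.symm' hxz) hwy)) (A.symm' hxz)
  · rw [hs, hf0, hfm]
    exact Or.inl (A.refl' _)
  · exact fun x hx => scross _ _ bot_le hx
  · refine Prod.ext (Subtype.ext ?_) (Subtype.ext ?_)
    · ext x y
      change s x y ↔ a x y
      rw [slow _ _ x.2, hf _ y.2.ne, hA, extendSubtype_coe]
    · ext x y
      change s x y ↔ b x y
      rw [shigh _ _ x.2 y.2, hB, extendSubtype_coe]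

lemma card_ncSetoidWithLast [OrderBot α] (m : α) : Nat.card (NCSetoidWithLast m) =
    Nat.card (NCSetoid (Set.Iio m)) * Nat.card (NCSetoid (Set.Ioi m)) := by
  rw [← Nat.card_prod]
  exact Nat.card_congr (Equiv.ofBijective _
    ⟨NCSetoidWithLast.split_injective m, NCSetoidWithLast.split_surjective m⟩)

lemma card_ncSetoid_eq_sum [OrderBot α] [Fintype α] :
    Nat.card (NCSetoid α) = ∑ m : α, Nat.card (NCSetoidWithLast m) := by
  rw [← Nat.card_sigma]
  symm
  refine Nat.card_congr (Equiv.ofBijective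
    (fun p : (Σ m : α, NCSetoidWithLast m) => (⟨p.2.1, p.2.2.1⟩ : NCSetoid α)) ⟨?_, ?_⟩)
  · rintro ⟨m, s, hs, hm, hlast⟩ ⟨m', s', hs', hm', hlast'⟩ h
    obtain rfl : s = s' := congrArg Subtype.val h
    obtain rfl : m = m' := le_antisymm (not_lt.1 fun h => hlast' _ h hm)
      (not_lt.1 fun h => hlast _ h hm')
    rfl
  · rintro ⟨s, hs⟩
    obtain ⟨m, hm, hmax⟩ := (Set.toFinite {x | s ⊥ x}).exists_maximal ⟨⊥, s.refl' _⟩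
    exact ⟨⟨m, s, hs, hm, fun x hx h => (hmax h hx.le).not_gt hx⟩, rfl⟩

theorem card_ncSetoid_fin (n : ℕ) : Nat.card (NCSetoid (Fin n)) = catalan n := by
  induction n using Nat.strong_induction_on with
  | _ n ih =>
    have key : ∀ (S : Set (Fin n)) (k : ℕ), k < n → Nat.card S = k →
        Nat.card (NCSetoid S) = catalan k := fun S k hk hS => by
      rw [← ih k hk]
      exact (card_ncSetoid_congr (Fintype.orderIsoFinOfCardEq S
        (Nat.card_eq_fintype_card.symm.trans hS))).symm
    cases n with
    | zero =>
      rw [catalan_zero, Nat.card_eq_one_iff_unique]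
      exact ⟨⟨fun s t => Subtype.ext (Setoid.ext fun a => a.elim0)⟩, ⟨⟨⊤, noncrossing_top⟩⟩⟩
    | succ n =>
      rw [card_ncSetoid_eq_sum, catalan_succ]
      refine Finset.sum_congr rfl fun m _ => ?_
      rw [card_ncSetoidWithLast, key _ m m.2 (by simp),
        key _ (n - m) (by omega) (by simp)]

end Catalan

section Join

variable {α ι : Type*} [LinearOrder α]

/-- Every tuple of noncrossing equivalence relations has a unique noncrossing join. -/
noncomputable def sigmaNCJoinTupleEquiv :
    (Σ s : NCSetoid α, NCJoinTuple ι s.1) ≃ (ι → NCSetoid α) :=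
  Equiv.ofBijective (fun p i => ⟨p.2.1 i, p.2.2.1 i⟩) <| by
    constructor
    · rintro ⟨⟨s, hs⟩, σ, hσ, hj⟩ ⟨⟨s', hs'⟩, σ', hσ', hj'⟩ h
      obtain rfl : σ = σ' := funext fun i => congrArg Subtype.val (congrFun h i)
      obtain rfl := hj.unique hj'
      rfl
    · intro σ
      obtain ⟨s, hs⟩ := exists_isNCJoin fun i => (σ i).1
      exact ⟨⟨⟨s, hs.1⟩, fun i => (σ i).1, fun i => (σ i).2, hs⟩, rfl⟩

lemma card_ncJoinTuple_top_congr {β : Type*} [LinearOrder β] (e : α ≃o β) :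
    Nat.card (NCJoinTuple ι (⊤ : Setoid α)) = Nat.card (NCJoinTuple ι (⊤ : Setoid β)) := by
  refine (Nat.card_congr ((Equiv.piCongrRight fun _ => comapOrderIso e).subtypeEquiv
    fun σ => ?_)).symm
  exact and_congr (forall_congr' fun i => (noncrossing_comapOrderIso_iff e).symm)
    (isNCJoin_comapOrderIso_iff (s := ⊤) e).symm

variable [Fintype α]

namespace Finpartition

/-- The equivalence relation of lying in the same block. -/
def toSetoid (π : Finpartition (univ : Finset α)) : Setoid α where
  r x y := ∃ p ∈ π.parts, x ∈ p ∧ y ∈ p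
  iseqv :=
    { refl := fun x => (π.exists_mem (mem_univ x)).imp fun _ h => ⟨h.1, h.2, h.2⟩
      symm := fun ⟨p, hp, hx, hy⟩ => ⟨p, hp, hy, hx⟩
      trans := fun ⟨p, hp, hx, hy⟩ ⟨_, hq, hy', hz⟩ =>
        ⟨p, hp, hx, π.eq_of_mem_parts hq hp hy' hy ▸ hz⟩ }

lemma toSetoid_rel {π : Finpartition (univ : Finset α)} {x y : α} :
    π.toSetoid x y ↔ ∃ p ∈ π.parts, x ∈ p ∧ y ∈ p := Iff.rfl

lemma toSetoid_rel_iff_of_mem {π : Finpartition (univ : Finset α)} {p : Finset α}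
    (hp : p ∈ π.parts) {x y : α} (hx : x ∈ p) : π.toSetoid x y ↔ y ∈ p :=
  ⟨fun ⟨_, hq, hx', hy⟩ => π.eq_of_mem_parts hq hp hx' hx ▸ hy, fun hy => ⟨p, hp, hx, hy⟩⟩

lemma toSetoid_le_iff {π π' : Finpartition (univ : Finset α)} :
    π.toSetoid ≤ π'.toSetoid ↔ π ≤ π' := by
  constructor
  · intro h p hp
    obtain ⟨x, hx⟩ := π.nonempty_of_mem_parts hp
    obtain ⟨q, hq, hxq⟩ := π'.exists_mem (mem_univ x)
    exact ⟨q, hq, fun y hy =>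
      (toSetoid_rel_iff_of_mem hq hxq).1 (h ((toSetoid_rel_iff_of_mem hp hx).2 hy))⟩
  · rintro h x y ⟨p, hp, hx, hy⟩
    obtain ⟨q, hq, hpq⟩ := h hp
    exact ⟨q, hq, hpq hx, hpq hy⟩

/-- Finpartitions of a finite type correspond to equivalence relations. -/
noncomputable def equivSetoid : Finpartition (univ : Finset α) ≃ Setoid α :=
  Equiv.ofBijective toSetoid <| by
    constructor
    · exact fun π π' h => le_antisymm (toSetoid_le_iff.1 h.le) (toSetoid_le_iff.1 h.ge)
    · intro s
      refine ⟨ofSetoid s, Setoid.ext fun x y => ?_⟩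
      rw [toSetoid_rel, ← mem_part_iff_exists, mem_part_ofSetoid_iff_rel, s.comm']

lemma equivSetoid_apply (π : Finpartition (univ : Finset α)) : equivSetoid π = π.toSetoid := rfl

lemma toSetoid_eq_top_iff [Nonempty α] {π : Finpartition (univ : Finset α)} :
    π.toSetoid = ⊤ ↔ π.parts = {univ} := by
  constructor
  · intro h
    have key : ∀ p ∈ π.parts, p = univ := by
      intro p hp
      obtain ⟨x, hx⟩ := π.nonempty_of_mem_parts hp
      exact Finset.eq_univ_of_forall fun y =>
        (toSetoid_rel_iff_of_mem hp hx).1 (h ▸ trivial)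
    exact Finset.eq_singleton_iff_nonempty_unique_mem.2
      ⟨π.parts_nonempty Finset.univ_nonempty.ne_empty, key⟩
  · intro h
    exact Setoid.eq_top_iff.2 fun x y => ⟨univ, by simp [h], mem_univ x, mem_univ y⟩

end Finpartition

lemma isNoncrossing_iff_toSetoid {n : ℕ} (π : Finpartition (univ : Finset (Fin n))) :
    IsNoncrossing π ↔ π.toSetoid.Noncrossing := by
  constructor
  · rintro h a b c d hab hbc hcd ⟨p, hp, ha, hc⟩ ⟨q, hq, hb, hd⟩
    exact ⟨p, hp, ha, h p hp q hq a b c d hab hbc hcd ha hc hb hd ▸ hb⟩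
  · intro h p hp q hq a b c d hab hbc hcd ha hc hb hd
    exact π.eq_of_mem_parts hp hq ((Finpartition.toSetoid_rel_iff_of_mem hp ha).1
      (h hab hbc hcd ⟨p, hp, ha, hc⟩ ⟨q, hq, hb, hd⟩)) hb

lemma ncJoinEqOne_iff_toSetoid {n : ℕ} [NeZero n]
    (σ : ι → Finpartition (univ : Finset (Fin n))) :
    NCJoinEqOne σ ↔ IsNCJoin (fun i => (σ i).toSetoid) ⊤ := by
  simp only [NCJoinEqOne, IsNCJoin, noncrossing_top, le_top, implies_true, true_and, top_le_iff,
    Finpartition.equivSetoid.surjective.forall, Finpartition.equivSetoid_apply,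
    isNoncrossing_iff_toSetoid, Finpartition.toSetoid_le_iff, Finpartition.toSetoid_eq_top_iff]

lemma ncJoinCount_eq_card (k n : ℕ) [NeZero n] :
    ncJoinCount k n = Nat.card (NCJoinTuple (Fin k) (⊤ : Setoid (Fin n))) := by
  rw [ncJoinCount, ← Fintype.card_subtype, ← Nat.card_eq_fintype_card]
  refine Nat.card_congr
    ((Equiv.piCongrRight fun _ => Finpartition.equivSetoid).subtypeEquiv fun σ => ?_)
  exact and_congr (forall_congr' fun i => isNoncrossing_iff_toSetoid (σ i))
    (ncJoinEqOne_iff_toSetoid σ)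

/-- Restrict a tuple with join `π` to the blocks of `π`. -/
def NCJoinTuple.restrict (π : Finpartition (univ : Finset α)) (hπ : π.toSetoid.Noncrossing)
    (σ : NCJoinTuple ι π.toSetoid) (p : π.parts) : NCJoinTuple ι (⊤ : Setoid p.1) :=
  ⟨fun i => (σ.1 i).comap Subtype.val, fun i => (σ.2.1 i).comap (Subtype.strictMono_coe _), by
    refine ⟨noncrossing_top, fun _ => le_top, fun t ht hσt x y _ => ?_⟩
    let u : Setoid α :=
      { r := fun x y => π.toSetoid x y ∧ ∀ (hx : x ∈ p.1) (hy : y ∈ p.1), t ⟨x, hx⟩ ⟨y, hy⟩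
        iseqv :=
          { refl := fun x => ⟨π.toSetoid.refl' x, fun _ _ => t.refl' _⟩
            symm := fun h => ⟨π.toSetoid.symm' h.1, fun hx hy => t.symm' (h.2 hy hx)⟩
            trans := fun {a b c} h h' => ⟨π.toSetoid.trans' h.1 h'.1, fun ha hc =>
              have hb := (Finpartition.toSetoid_rel_iff_of_mem p.2 ha).1 h.1
              t.trans' (h.2 ha hb) (h'.2 hb hc)⟩ } }
    have hu : u.Noncrossing := by
      intro a b c d hab hbc hcd hac hbd
      refine ⟨hπ hab hbc hcd hac.1 hbd.1, fun ha hb => ?_⟩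
      have hc := (Finpartition.toSetoid_rel_iff_of_mem p.2 ha).1 hac.1
      have hd := (Finpartition.toSetoid_rel_iff_of_mem p.2 hb).1 hbd.1
      exact ht (a := ⟨a, ha⟩) (b := ⟨b, hb⟩) (c := ⟨c, hc⟩) (d := ⟨d, hd⟩) hab hbc hcd
        (hac.2 ha hc) (hbd.2 hb hd)
    have hle : π.toSetoid ≤ u := σ.2.2.2.2 u hu fun i a b hab =>
      ⟨σ.2.2.2.1 i hab, fun ha hb => hσt i (x := ⟨a, ha⟩) (y := ⟨b, hb⟩) hab⟩
    exact (hle ⟨p.1, p.2, x.2, y.2⟩).2 x.2 y.2⟩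

lemma NCJoinTuple.restrict_injective (π : Finpartition (univ : Finset α))
    (hπ : π.toSetoid.Noncrossing) :
    Function.Injective (NCJoinTuple.restrict (ι := ι) π hπ) := by
  have key : ∀ σ τ : NCJoinTuple ι π.toSetoid, restrict π hπ σ = restrict π hπ τ →
      ∀ i, σ.1 i ≤ τ.1 i := by
    intro σ τ h i x y hxy
    obtain ⟨p, hp, hx, hy⟩ := σ.2.2.2.1 i hxy
    have h1 := congrArg (fun u => (u ⟨p, hp⟩).1 i ⟨x, hx⟩ ⟨y, hy⟩) h
    exact (iff_of_eq h1).1 hxy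
  exact fun σ τ h => Subtype.ext (funext fun i => le_antisymm (key σ τ h i) (key τ σ h.symm i))

lemma NCJoinTuple.restrict_surjective (π : Finpartition (univ : Finset α))
    (hπ : π.toSetoid.Noncrossing) :
    Function.Surjective (NCJoinTuple.restrict (ι := ι) π hπ) := by
  intro τ
  let σ : ι → Setoid α := fun i =>
    { r := fun x y => ∃ (p : π.parts) (hx : x ∈ p.1) (hy : y ∈ p.1), (τ p).1 i ⟨x, hx⟩ ⟨y, hy⟩
      iseqv :=
        { refl := fun x =>
            have ⟨p, hp, hx⟩ := π.exists_mem (mem_univ x)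
            ⟨⟨p, hp⟩, hx, hx, ((τ ⟨p, hp⟩).1 i).refl' _⟩
          symm := fun ⟨p, hx, hy, h⟩ => ⟨p, hy, hx, ((τ p).1 i).symm' h⟩
          trans := by
            rintro x y z ⟨p, hx, hy, h⟩ ⟨q, hy', hz, h'⟩
            obtain rfl : p = q := Subtype.ext (π.eq_of_mem_parts p.2 q.2 hy hy')
            exact ⟨p, hx, hz, ((τ p).1 i).trans' h h'⟩ } }
  have hσ : ∀ i (p : π.parts) (x y : p.1), σ i x y ↔ (τ p).1 i x y := by
    refine fun i p x y => ⟨?_, fun h => ⟨p, x.2, y.2, h⟩⟩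
    rintro ⟨q, hx, hy, h⟩
    obtain rfl : p = q := Subtype.ext (π.eq_of_mem_parts p.2 q.2 x.2 hx)
    exact h
  refine ⟨⟨σ, fun i => ?_, hπ, fun i x y ⟨p, hx, hy, _⟩ => ⟨p.1, p.2, hx, hy⟩,
    fun t ht hσt x y hxy => ?_⟩, funext fun p => Subtype.ext (funext fun i => Setoid.ext (hσ i p))⟩
  · intro a b c d hab hbc hcd ⟨p, ha, hc, hac⟩ ⟨q, hb, hd, hbd⟩
    have h := hπ hab hbc hcd ⟨p.1, p.2, ha, hc⟩ ⟨q.1, q.2, hb, hd⟩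
    obtain rfl : p = q := Subtype.ext (π.eq_of_mem_parts p.2 q.2
      ((Finpartition.toSetoid_rel_iff_of_mem p.2 ha).1 h) hb)
    have hτ : ((τ p).1 i).Noncrossing := (τ p).2.1 i
    exact ⟨p, ha, hb, hτ (a := ⟨a, ha⟩) (b := ⟨b, hb⟩) (c := ⟨c, hc⟩) (d := ⟨d, hd⟩)
      hab hbc hcd hac hbd⟩
  · obtain ⟨p, hp, hx, hy⟩ := hxy
    have h := (τ ⟨p, hp⟩).2.2.2.2 (t.comap Subtype.val) (ht.comap (Subtype.strictMono_coe _))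
      fun i a b hab => hσt i ((hσ i ⟨p, hp⟩ a b).2 hab)
    exact h (x := ⟨x, hx⟩) (y := ⟨y, hy⟩) trivial

lemma card_ncJoinTuple_toSetoid (π : Finpartition (univ : Finset α))
    (hπ : π.toSetoid.Noncrossing) (k : ℕ) :
    Nat.card (NCJoinTuple (Fin k) π.toSetoid) = ∏ p ∈ π.parts, ncJoinCount k p.card := by
  rw [Nat.card_congr (Equiv.ofBijective _ ⟨NCJoinTuple.restrict_injective π hπ,
    NCJoinTuple.restrict_surjective π hπ⟩), Nat.card_pi,
    ← Finset.prod_coe_sort π.parts fun p => ncJoinCount k p.card]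
  refine Finset.prod_congr rfl fun p _ => ?_
  have : NeZero p.1.card := ⟨(Finset.card_pos.2 (π.nonempty_of_mem_parts p.2)).ne'⟩
  rw [ncJoinCount_eq_card]
  exact (card_ncJoinTuple_top_congr (p.1.orderIsoOfFin rfl)).symm

end Join

/-- For every `k ≥ 1` and `n ≥ 1`, `Cat_n ^ k = ∑_{π ∈ NC(n)} ∏_{p ∈ π} Q k |p|`; that is,
`(Q k m)_{m ≥ 1}` is the free cumulant sequence of the moment sequence `(Cat_n ^ k)_{n ≥ 1}`
(the moments of `X₁² ⋯ X_k²` for independent standard semicircular variables). -/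
theorem catalan_pow_eq_sum_ncJoinCount (k : ℕ) (hk : 1 ≤ k) (n : ℕ) (hn : 1 ≤ n) :
    catalan n ^ k =
      ∑ π ∈ (univ : Finset (Finpartition (univ : Finset (Fin n)))).filter IsNoncrossing,
        ∏ p ∈ π.parts, ncJoinCount k p.card := by
  have hpow : catalan n ^ k = Nat.card (Fin k → NCSetoid (Fin n)) := by
    rw [Nat.card_fun, card_ncSetoid_fin, Nat.card_fin]
  have : Fintype (NCSetoid (Fin n)) := Fintype.ofFinite _
  rw [hpow, ← Nat.card_congr sigmaNCJoinTupleEquiv, Nat.card_sigma,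
    Finset.sum_subtype _ (p := IsNoncrossing) fun π => by simp]
  exact (Fintype.sum_equiv (Finpartition.equivSetoid.subtypeEquiv isNoncrossing_iff_toSetoid) _ _
    fun π => (card_ncJoinTuple_toSetoid π.1 ((isNoncrossing_iff_toSetoid _).1 π.2) k).symm).symm
end

section
/- Let X be a finite lattice and let φ : X → ℂ be any function. Let Φ be the X×X matrix with entries Φ(x,y) = φ(x ∧ y). Then det(Φ) = ∏_{x ∈ X} φ̂(x), where φ̂(x) = Σ_{y ≤ x} μ(x,y) φ(y) and μ is the Möbius function of the poset X. -/
open Finset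
open scoped Classical

open Matrix in
/-- A matrix indexed by a finite partial order and supported on `{(x, y) | y ≤ x}` has determinant
the product of its diagonal entries. -/
theorem det_eq_prod_diag_of_supported_le {X R : Type*} [Fintype X] [DecidableEq X]
    [PartialOrder X] [CommRing R]
    (N : Matrix X X R) (hN : ∀ x y, ¬ y ≤ x → N x y = 0) : N.det = ∏ x, N x x := by
  let e : X ≃ LinearExtension X := Equiv.refl X
  let _ : Fintype (LinearExtension X) := Fintype.ofEquiv X e
  have h : (reindex e e N).IsLowerTriangular := fun x y hxy ↦
    hN (e.symm x) (e.symm y) fun hle ↦ not_le_of_gt (OrderDual.toDual_lt_toDual.mp hxy)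
      ((toLinearExtension (α := X)).monotone hle)
  rw [← det_reindex_self e N, det_of_isLowerTriangular _ h]
  exact (Equiv.prod_comp e _).symm

/-- The zeta matrix of a poset: the indicator of `y ≤ x`. -/
noncomputable def zetaMatrix (X R : Type*) [LE X] [Zero R] [One R] : Matrix X X R :=
  Matrix.of fun x y ↦ if y ≤ x then 1 else 0

theorem det_zetaMatrix (X R : Type*) [Fintype X] [PartialOrder X] [CommRing R] :
    (zetaMatrix X R).det = 1 := by
  rw [det_eq_prod_diag_of_supported_le (zetaMatrix X R) fun x y h ↦ if_neg h]
  simp [zetaMatrix]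

open Matrix in
/-- If `f = ζ g`, then the meet matrix of `f` is `ζ * diagonal g * ζᵀ`. -/
theorem meet_matrix_eq_zetaMatrix_mul {X R : Type*} [Fintype X] [SemilatticeInf X] [CommRing R]
    (f g : X → R) (h : zetaMatrix X R *ᵥ g = f) :
    Matrix.of (fun x y : X ↦ f (x ⊓ y)) =
      zetaMatrix X R * diagonal g * (zetaMatrix X R)ᵀ := by
  ext x y
  rw [← h, mul_apply]
  simp [mulVec, dotProduct, mul_diagonal, zetaMatrix, ← ite_and, and_comm]

/-- **Lindström-type determinant formula.** Let `X` be a finite lattice, `φ : X → ℂ` any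
function, and let `μ` be the Möbius function of the poset `X`, characterized by
`∑_{y ≤ u ≤ x} μ(x,u) = δ_{x,y}` for `y ≤ x`.  Then the matrix `Φ(x,y) = φ(x ⊓ y)` has
determinant `∏_{x ∈ X} φ̂(x)`, where `φ̂(x) = ∑_{y ≤ x} μ(x,y) φ(y)`. -/
theorem det_meet_matrix_eq_prod_mobius_transform
    {X : Type*} [Fintype X] [Lattice X] (φ : X → ℂ) (μ : X → X → ℂ)
    (hμ : ∀ x y : X, y ≤ x →
      (∑ u ∈ (univ : Finset X).filter (fun u => y ≤ u ∧ u ≤ x), μ x u) =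
        if x = y then 1 else 0) :
    Matrix.det (Matrix.of fun x y : X => φ (x ⊓ y)) =
      ∏ x : X, ∑ y ∈ (univ : Finset X).filter (fun y => y ≤ x), μ x y * φ y := by
  let M : Matrix X X ℂ := Matrix.of fun x u ↦ if u ≤ x then μ x u else 0
  have hM : M * zetaMatrix X ℂ = 1 := by
    ext x y
    by_cases hyx : y ≤ x
    · rw [Matrix.one_apply, ← hμ x y hyx, Matrix.mul_apply, sum_filter]
      refine sum_congr rfl fun u _ ↦ ?_
      simp [M, zetaMatrix, ite_and]
    · rw [Matrix.one_apply_ne (fun h ↦ hyx h.ge), Matrix.mul_apply]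
      refine sum_eq_zero fun u _ ↦ ?_
      by_cases hux : u ≤ x
      · have hyu : ¬ y ≤ u := fun h ↦ hyx (h.trans hux)
        simp [zetaMatrix, hyu]
      · simp [M, hux]
  have hφ : (zetaMatrix X ℂ).mulVec (M.mulVec φ) = φ := by
    rw [Matrix.mulVec_mulVec, mul_eq_one_comm.mp hM, Matrix.one_mulVec]
  rw [meet_matrix_eq_zetaMatrix_mul φ _ hφ]
  simp [det_zetaMatrix, M, Matrix.mulVec, dotProduct, sum_filter]
end

section
/- For n ≥ 1, let Φ_n be the Cat_n × Cat_n matrix with rows and columns indexed by NC(n) and entries Φ_n(π,π′) = 1 if π ∧ π′ = 0_n and Φ_n(π,π′) = 0 otherwise (this is, up to a permutation of columns given by the Kreweras complement, the incidence matrix of the dual braid normality relation). Then |det(Φ_n)| = ∏_{k=2}^{n} Cat_{k-1}^{binom(2n-k-1, n-1)}, where binom denotes the binomial coefficient. -/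
open Finset
open scoped Classical

section NoncrossingFamilies

variable {α : Type*} [LinearOrder α]

/-- A family of finsets is noncrossing if no two distinct members cross. -/
def NoncrossingFamily (σ : Finset (Finset α)) : Prop :=
  ∀ p ∈ σ, ∀ q ∈ σ, ∀ i j k l : α,
    i < j → j < k → k < l → i ∈ p → k ∈ p → j ∈ q → l ∈ q → p = q

/-- The set of noncrossing partitions of a finset, each given by its set of blocks. -/
noncomputable def ncPartitions (s : Finset α) : Finset (Finset (Finset α)) :=
  s.powerset.powerset.filter fun σ =>
    ∅ ∉ σ ∧ (∀ x ∈ s, ∃ B ∈ σ, x ∈ B) ∧ (∀ B ∈ σ, ∀ C ∈ σ, ∀ x ∈ B, x ∈ C → B = C) ∧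
      NoncrossingFamily σ

theorem mem_ncPartitions {s : Finset α} {σ : Finset (Finset α)} :
    σ ∈ ncPartitions s ↔ (∀ B ∈ σ, B ⊆ s) ∧ ∅ ∉ σ ∧ (∀ x ∈ s, ∃ B ∈ σ, x ∈ B) ∧
      (∀ B ∈ σ, ∀ C ∈ σ, ∀ x ∈ B, x ∈ C → B = C) ∧ NoncrossingFamily σ := by
  simp only [ncPartitions, mem_filter, mem_powerset, subset_iff]

theorem ncPartitions_empty : ncPartitions (∅ : Finset α) = {∅} := by
  ext σ
  rw [mem_ncPartitions, mem_singleton]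
  constructor
  · rintro ⟨h1, h2, -⟩
    rw [eq_empty_iff_forall_notMem]
    intro B hB
    exact h2 (subset_empty.1 (h1 B hB) ▸ hB)
  · rintro rfl
    simp [NoncrossingFamily]

/-- The noncrossing partitions of `⋃ π` refining the family `π`. -/
noncomputable def ncRefinements (π : Finset (Finset α)) : Finset (Finset (Finset α)) :=
  (ncPartitions (π.biUnion id)).filter fun σ => ∀ B ∈ σ, ∃ C ∈ π, B ⊆ C

theorem sum_ncRefinements {R : Type*} [CommSemiring R] (h : Finset α → R)
    (π : Finset (Finset α)) (hd : ∀ B ∈ π, ∀ C ∈ π, ∀ x ∈ B, x ∈ C → B = C)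
    (hnc : NoncrossingFamily π) :
    ∑ σ ∈ ncRefinements π, ∏ B ∈ σ, h B = ∏ C ∈ π, ∑ σ ∈ ncPartitions C, ∏ B ∈ σ, h B := by
  induction π using Finset.induction_on with
  | empty =>
    have : ncRefinements (∅ : Finset (Finset α)) = {∅} := by
      ext σ
      simp only [ncRefinements, biUnion_empty, ncPartitions_empty, mem_filter, mem_singleton]
      constructor
      · exact fun h => h.1
      · rintro rfl
        simp
    simp [this]
  | insert C π hC ih =>
    have hd' : ∀ B ∈ π, ∀ D ∈ π, ∀ x ∈ B, x ∈ D → B = D := fun B hB D hD =>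
      hd B (mem_insert_of_mem hB) D (mem_insert_of_mem hD)
    have hnc' : NoncrossingFamily π := fun p hp q hq =>
      hnc p (mem_insert_of_mem hp) q (mem_insert_of_mem hq)
    have hdC : ∀ D ∈ π, ∀ x ∈ C, x ∉ D := fun D hD x hx hx' =>
      hC (hd C (mem_insert_self _ _) D (mem_insert_of_mem hD) x hx hx' ▸ hD)
    rw [prod_insert hC, ← ih hd' hnc', sum_mul_sum, ← sum_product']
    symm
    refine Finset.sum_nbij' (fun q => q.1 ∪ q.2)
      (fun σ => (σ.filter (· ⊆ C), σ.filter (¬ · ⊆ C))) ?_ ?_ ?_ ?_ ?_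
    · rintro ⟨σ, τ⟩ hστ
      simp only [mem_product, ncRefinements, mem_filter, mem_ncPartitions] at hστ
      obtain ⟨⟨a1, a2, a3, a4, a5⟩, ⟨b1, b2, b3, b4, b5⟩, b6⟩ := hστ
      simp only [ncRefinements, mem_filter, mem_ncPartitions]
      have cross : ∀ B ∈ σ, ∀ D ∈ τ, ∀ x ∈ B, x ∉ D := by
        intro B hB D hD x hx hx'
        obtain ⟨E, hE, hDE⟩ := b6 D hD
        exact hdC E hE x (a1 B hB hx) (hDE hx')
      refine ⟨⟨?_, ?_, ?_, ?_, ?_⟩, ?_⟩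
      · intro B hB
        rw [biUnion_insert]
        rcases mem_union.1 hB with hB | hB
        · exact (a1 B hB).trans subset_union_left
        · exact (b1 B hB).trans subset_union_right
      · simp [a2, b2]
      · intro x hx
        rw [biUnion_insert, mem_union] at hx
        rcases hx with hx | hx
        · obtain ⟨B, hB, hxB⟩ := a3 x hx
          exact ⟨B, mem_union_left _ hB, hxB⟩
        · obtain ⟨B, hB, hxB⟩ := b3 x hx
          exact ⟨B, mem_union_right _ hB, hxB⟩
      · intro B hB D hD x hx hx'
        rcases mem_union.1 hB with hB | hB <;> rcases mem_union.1 hD with hD | hD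
        · exact a4 B hB D hD x hx hx'
        · exact absurd hx' (cross B hB D hD x hx)
        · exact absurd hx (cross D hD B hB x hx')
        · exact b4 B hB D hD x hx hx'
      · intro p hp q hq i j k l hij hjk hkl hi hk hj hl
        rcases mem_union.1 hp with hp | hp <;> rcases mem_union.1 hq with hq | hq
        · exact a5 p hp q hq i j k l hij hjk hkl hi hk hj hl
        · obtain ⟨E, hE, hqE⟩ := b6 q hq
          have := hnc C (mem_insert_self _ _) E (mem_insert_of_mem hE) i j k l hij hjk hkl
            (a1 p hp hi) (a1 p hp hk) (hqE hj) (hqE hl)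
          exact absurd (this ▸ hE) hC
        · obtain ⟨E, hE, hpE⟩ := b6 p hp
          have := hnc E (mem_insert_of_mem hE) C (mem_insert_self _ _) i j k l hij hjk hkl
            (hpE hi) (hpE hk) (a1 q hq hj) (a1 q hq hl)
          exact absurd (this ▸ hE) hC
        · exact b5 p hp q hq i j k l hij hjk hkl hi hk hj hl
      · intro B hB
        rcases mem_union.1 hB with hB | hB
        · exact ⟨C, mem_insert_self _ _, a1 B hB⟩
        · obtain ⟨E, hE, hBE⟩ := b6 B hB
          exact ⟨E, mem_insert_of_mem hE, hBE⟩
    · intro σ hσ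
      simp only [ncRefinements, mem_filter, mem_ncPartitions] at hσ
      obtain ⟨⟨a1, a2, a3, a4, a5⟩, a6⟩ := hσ
      have key : ∀ B ∈ σ, ¬ B ⊆ C → ∃ E ∈ π, B ⊆ E := by
        intro B hB hBC
        obtain ⟨E, hE, hBE⟩ := a6 B hB
        rcases mem_insert.1 hE with rfl | hE
        · exact absurd hBE hBC
        · exact ⟨E, hE, hBE⟩
      simp only [mem_product, ncRefinements, mem_filter, mem_ncPartitions]
      refine ⟨⟨fun B hB => hB.2, fun h => a2 h.1, ?_, ?_, ?_⟩,
        ⟨?_, fun h => a2 h.1, ?_, ?_, ?_⟩, fun B hB => key B hB.1 hB.2⟩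
      · intro x hx
        obtain ⟨B, hB, hxB⟩ := a3 x (by rw [biUnion_insert]; exact mem_union_left _ hx)
        refine ⟨B, ⟨hB, ?_⟩, hxB⟩
        by_contra hBC
        obtain ⟨E, hE, hBE⟩ := key B hB hBC
        exact hdC E hE x hx (hBE hxB)
      · exact fun B hB D hD => a4 B hB.1 D hD.1
      · exact fun p hp q hq => a5 p (mem_filter.1 hp).1 q (mem_filter.1 hq).1
      · intro B hB
        obtain ⟨E, hE, hBE⟩ := key B hB.1 hB.2
        exact hBE.trans (subset_biUnion_of_mem id hE)
      · intro x hx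
        obtain ⟨B, hB, hxB⟩ := a3 x (by rw [biUnion_insert]; exact mem_union_right _ hx)
        refine ⟨B, ⟨hB, fun hBC => ?_⟩, hxB⟩
        obtain ⟨E, hE, hxE⟩ := mem_biUnion.1 hx
        exact hdC E hE x (hBC hxB) hxE
      · exact fun B hB D hD => a4 B hB.1 D hD.1
      · exact fun p hp q hq => a5 p (mem_filter.1 hp).1 q (mem_filter.1 hq).1
    · rintro ⟨σ, τ⟩ hστ
      simp only [mem_product, ncRefinements, mem_filter, mem_ncPartitions] at hστ
      obtain ⟨⟨a1, -⟩, ⟨-, b2, -⟩, b6⟩ := hστ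
      have hτ : ∀ B ∈ τ, ¬ B ⊆ C := by
        intro B hB hBC
        obtain ⟨E, hE, hBE⟩ := b6 B hB
        obtain ⟨x, hx⟩ : B.Nonempty := nonempty_iff_ne_empty.2 fun h => b2 (h ▸ hB)
        exact hdC E hE x (hBC hx) (hBE hx)
      ext B
      · simp only [mem_filter, mem_union]
        exact ⟨fun h => h.1.resolve_right fun h' => hτ B h' h.2, fun h => ⟨Or.inl h, a1 B h⟩⟩
      · simp only [mem_filter, mem_union]
        exact ⟨fun h => h.1.resolve_left fun h' => h.2 (a1 B h'), fun h => ⟨Or.inr h, hτ B h⟩⟩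
    · intro σ _
      exact filter_union_filter_not_eq _ _
    · rintro ⟨σ, τ⟩ hστ
      simp only [mem_product, ncRefinements, mem_filter, mem_ncPartitions] at hστ
      obtain ⟨⟨a1, -⟩, ⟨-, b2, -⟩, b6⟩ := hστ
      refine (prod_union ?_).symm
      rw [disjoint_left]
      intro B hB hB'
      obtain ⟨E, hE, hBE⟩ := b6 B hB'
      obtain ⟨x, hx⟩ : B.Nonempty := nonempty_iff_ne_empty.2 fun h => b2 (h ▸ hB')
      exact hdC E hE x (a1 B hB hx) (hBE hx)

theorem sum_ncPartitions_insert_singleton {R : Type*} [CommSemiring R] (h : Finset α → R)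
    {a : α} {s : Finset α} (ha : ∀ x ∈ s, a < x) :
    ∑ σ ∈ (ncPartitions (insert a s)).filter ({a} ∈ ·), ∏ B ∈ σ, h B =
      h {a} * ∑ σ ∈ ncPartitions s, ∏ B ∈ σ, h B := by
  have has : a ∉ s := fun h => lt_irrefl a (ha a h)
  rw [mul_sum]
  symm
  have hnot : ∀ σ ∈ ncPartitions s, {a} ∉ σ := fun σ hσ h =>
    has (singleton_subset_iff.1 ((mem_ncPartitions.1 hσ).1 _ h))
  refine Finset.sum_nbij' (fun σ => insert {a} σ) (fun σ => σ.erase {a}) ?_ ?_ ?_ ?_ ?_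
  · intro σ hσ
    obtain ⟨a1, a2, a3, a4, a5⟩ := mem_ncPartitions.1 hσ
    rw [mem_filter, mem_ncPartitions]
    refine ⟨⟨?_, ?_, ?_, ?_, ?_⟩, mem_insert_self _ _⟩
    · intro B hB
      rcases mem_insert.1 hB with rfl | hB
      · simp
      · exact (a1 B hB).trans (subset_insert _ _)
    · simp [a2]
    · intro x hx
      rcases mem_insert.1 hx with rfl | hx
      · exact ⟨_, mem_insert_self _ _, mem_singleton_self _⟩
      · obtain ⟨B, hB, hxB⟩ := a3 x hx
        exact ⟨B, mem_insert_of_mem hB, hxB⟩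
    · intro B hB C hC x hx hx'
      rcases mem_insert.1 hB with rfl | hB <;> rcases mem_insert.1 hC with rfl | hC
      · rfl
      · exact absurd (mem_singleton.1 hx ▸ a1 C hC hx') has
      · exact absurd (mem_singleton.1 hx' ▸ a1 B hB hx) has
      · exact a4 B hB C hC x hx hx'
    · intro p hp q hq i j k l hij hjk hkl hi hk hj hl
      rcases mem_insert.1 hp with rfl | hp
      · rw [mem_singleton] at hi hk
        subst hi hk
        exact absurd (hij.trans hjk) (lt_irrefl _)
      rcases mem_insert.1 hq with rfl | hq
      · rw [mem_singleton] at hj hl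
        subst hj hl
        exact absurd (hjk.trans hkl) (lt_irrefl _)
      exact a5 p hp q hq i j k l hij hjk hkl hi hk hj hl
  · intro σ hσ
    rw [mem_filter, mem_ncPartitions] at hσ
    obtain ⟨⟨a1, a2, a3, a4, a5⟩, a6⟩ := hσ
    have hne : ∀ B ∈ σ.erase {a}, a ∉ B := fun B hB haB =>
      (mem_erase.1 hB).1 (a4 B (mem_erase.1 hB).2 _ a6 a haB (mem_singleton_self _))
    rw [mem_ncPartitions]
    refine ⟨?_, fun h => a2 (mem_of_mem_erase h), ?_, ?_, ?_⟩
    · intro B hB x hx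
      refine (mem_insert.1 (a1 B (mem_of_mem_erase hB) hx)).resolve_left ?_
      rintro rfl
      exact hne B hB hx
    · intro x hx
      obtain ⟨B, hB, hxB⟩ := a3 x (mem_insert_of_mem hx)
      refine ⟨B, mem_erase.2 ⟨?_, hB⟩, hxB⟩
      rintro rfl
      exact has (mem_singleton.1 hxB ▸ hx)
    · exact fun B hB C hC => a4 B (mem_of_mem_erase hB) C (mem_of_mem_erase hC)
    · exact fun p hp q hq => a5 p (mem_of_mem_erase hp) q (mem_of_mem_erase hq)
  · exact fun σ hσ => erase_insert (hnot σ hσ)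
  · exact fun σ hσ => insert_erase (mem_filter.1 hσ).2
  · exact fun σ hσ => (prod_insert (hnot σ hσ)).symm

/-- `b` is the least element other than `a` of the block of `σ` containing `a`. -/
def IsNextInBlock (σ : Finset (Finset α)) (a b : α) : Prop :=
  ∃ B ∈ σ, a ∈ B ∧ b ∈ B ∧ ∀ x ∈ B, x ≠ a → b ≤ x

theorem sum_ncPartitions_insert_next {R : Type*} [CommSemiring R] (h h' : Finset α → R)
    {a b : α} {s : Finset α} (ha : ∀ x ∈ s, a < x) (hb : b ∈ s)
    (hh : ∀ B, a ∉ B → h' B = if b ∈ B then h (insert a B) else h B) :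
    ∑ σ ∈ (ncPartitions (insert a s)).filter (IsNextInBlock · a b), ∏ B ∈ σ, h B =
      (∑ σ ∈ ncPartitions (s.filter (· < b)), ∏ B ∈ σ, h' B) *
        ∑ σ ∈ ncPartitions (s.filter (b ≤ ·)), ∏ B ∈ σ, h' B := by
  have has : a ∉ s := fun h => lt_irrefl a (ha a h)
  have hbU : b ∈ s.filter (b ≤ ·) := mem_filter.2 ⟨hb, le_rfl⟩
  have hne : s.filter (· < b) ≠ s.filter (b ≤ ·) := by
    intro h
    rw [← h] at hbU
    exact lt_irrefl b (mem_filter.1 hbU).2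
  have hunion : ({s.filter (· < b), s.filter (b ≤ ·)} : Finset (Finset α)).biUnion id = s := by
    ext x
    simp only [mem_biUnion, mem_insert, mem_singleton, exists_eq_or_imp, exists_eq_left, id,
      mem_filter]
    have := lt_or_ge x b
    tauto
  have hR : ∀ σ, σ ∈ ncRefinements {s.filter (· < b), s.filter (b ≤ ·)} ↔
      σ ∈ ncPartitions s ∧ ∀ B ∈ σ, (∀ x ∈ B, x < b) ∨ ∀ x ∈ B, b ≤ x := by
    intro σ
    rw [ncRefinements, mem_filter, hunion]
    refine and_congr_right fun hσ => forall₂_congr fun B hB => ?_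
    have hBs := (mem_ncPartitions.1 hσ).1 B hB
    simp only [mem_insert, mem_singleton, exists_eq_or_imp, exists_eq_left, subset_iff, mem_filter]
    exact or_congr ⟨fun h x hx => (h hx).2, fun h x hx => ⟨hBs hx, h x hx⟩⟩
      ⟨fun h x hx => (h hx).2, fun h x hx => ⟨hBs hx, h x hx⟩⟩
  rw [← prod_pair (f := fun C => ∑ σ ∈ ncPartitions C, ∏ B ∈ σ, h' B) hne, ← sum_ncRefinements]
  rotate_left
  · intro B hB C hC x hx hx'
    simp only [mem_insert, mem_singleton] at hB hC
    rcases hB with rfl | rfl <;> rcases hC with rfl | rfl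
    · rfl
    · exact absurd (mem_filter.1 hx).2 (not_lt.2 (mem_filter.1 hx').2)
    · exact absurd (mem_filter.1 hx').2 (not_lt.2 (mem_filter.1 hx).2)
    · rfl
  · intro p hp q hq i j k l hij hjk hkl hi hk hj hl
    simp only [mem_insert, mem_singleton] at hp hq
    rcases hp with rfl | rfl <;> rcases hq with rfl | rfl
    · rfl
    · exact absurd ((mem_filter.1 hj).2.trans_lt hjk) (not_lt.2 (mem_filter.1 hk).2.le)
    · exact absurd ((mem_filter.1 hi).2.trans_lt hij) (not_lt.2 (mem_filter.1 hj).2.le)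
    · rfl
  symm
  let φ : Finset α → Finset α := fun B => if b ∈ B then insert a B else B
  have φ_erase : ∀ B, a ∉ B → (φ B).erase a = B := by
    intro B hB
    by_cases hbB : b ∈ B
    · simp [φ, hbB, hB]
    · simp [φ, hbB, hB]
  have mem_φ : ∀ B x, x ∈ φ B → x ∈ B ∨ x = a ∧ b ∈ B := by
    intro B x hx
    by_cases hbB : b ∈ B
    · simp only [φ, hbB, if_true, mem_insert] at hx
      tauto
    · simp only [φ, hbB, if_false] at hx
      exact Or.inl hx
  have sub_φ : ∀ B, B ⊆ φ B := by
    intro B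
    by_cases hbB : b ∈ B
    · simp [φ, hbB]
    · simp [φ, hbB]
  have hσa : ∀ σ ∈ ncPartitions s, ∀ B ∈ σ, a ∉ B := fun σ hσ B hB h =>
    has ((mem_ncPartitions.1 hσ).1 B hB h)
  refine Finset.sum_nbij' (fun σ => σ.image φ) (fun σ => σ.image (·.erase a)) ?_ ?_ ?_ ?_ ?_
  · intro σ hσ
    obtain ⟨hσ, a6⟩ := (hR σ).1 hσ
    obtain ⟨a1, a2, a3, a4, a5⟩ := mem_ncPartitions.1 hσ
    rw [mem_filter, mem_ncPartitions]
    refine ⟨⟨?_, ?_, ?_, ?_, ?_⟩, ?_⟩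
    · intro B' hB'
      obtain ⟨B, hB, rfl⟩ := mem_image.1 hB'
      intro x hx
      rcases mem_φ B x hx with hx | ⟨rfl, -⟩
      · exact mem_insert_of_mem (a1 B hB hx)
      · exact mem_insert_self _ _
    · intro hE
      obtain ⟨B, hB, hBE⟩ := mem_image.1 hE
      exact a2 (subset_empty.1 (hBE ▸ sub_φ B) ▸ hB)
    · intro x hx
      rcases mem_insert.1 hx with rfl | hx
      · obtain ⟨B, hB, hbB⟩ := a3 b hb
        exact ⟨φ B, mem_image_of_mem _ hB, by simp [φ, hbB]⟩
      · obtain ⟨B, hB, hxB⟩ := a3 x hx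
        exact ⟨φ B, mem_image_of_mem _ hB, sub_φ B hxB⟩
    · intro B' hB' C' hC' x hx hx'
      obtain ⟨B, hB, rfl⟩ := mem_image.1 hB'
      obtain ⟨C, hC, rfl⟩ := mem_image.1 hC'
      congr 1
      rcases mem_φ B x hx with hx | ⟨rfl, hbB⟩ <;> rcases mem_φ C x hx' with hx' | ⟨hxa, hbC⟩
      · exact a4 B hB C hC x hx hx'
      · exact absurd (hxa ▸ hx) (hσa σ hσ B hB)
      · exact absurd hx' (hσa σ hσ C hC)
      · exact a4 B hB C hC b hbB hbC
    · intro p' hp' q' hq' i j k l hij hjk hkl hi hk hj hl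
      obtain ⟨p, hp, rfl⟩ := mem_image.1 hp'
      obtain ⟨q, hq, rfl⟩ := mem_image.1 hq'
      congr 1
      have hlow : ∀ r ∈ σ, ∀ x ∈ φ r, a ≤ x := by
        intro r hr x hx
        rcases mem_φ r x hx with hx | ⟨rfl, -⟩
        · exact (ha x (a1 r hr hx)).le
        · exact le_rfl
      have hgt : ∀ r ∈ σ, ∀ x ∈ φ r, a < x → x ∈ r := by
        intro r hr x hx hax
        rcases mem_φ r x hx with hx | ⟨rfl, -⟩
        · exact hx
        · exact absurd hax (lt_irrefl _)
      have hai := hlow p hp i hi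
      have hjq := hgt q hq j hj (hai.trans_lt hij)
      have hkp := hgt p hp k hk (hai.trans_lt (hij.trans hjk))
      have hlq := hgt q hq l hl (hai.trans_lt (hij.trans (hjk.trans hkl)))
      rcases mem_φ p i hi with hi | ⟨-, hbp⟩
      · exact a5 p hp q hq i j k l hij hjk hkl hi hkp hjq hlq
      · have hpb : ∀ x ∈ p, b ≤ x :=
          (a6 p hp).resolve_left fun h => lt_irrefl b (h b hbp)
        have hqb : ∀ x ∈ q, b ≤ x :=
          (a6 q hq).resolve_left fun h =>
            lt_irrefl b ((hpb k hkp).trans_lt (hkl.trans (h l hlq)))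
        rcases (hqb j hjq).eq_or_lt with hbj | hbj
        · exact a4 p hp q hq b hbp (hbj ▸ hjq)
        · exact a5 p hp q hq b j k l hbj hjk hkl hbp hkp hjq hlq
    · obtain ⟨B, hB, hbB⟩ := a3 b hb
      refine ⟨φ B, mem_image_of_mem _ hB, by simp [φ, hbB], sub_φ B hbB, ?_⟩
      intro x hx hxa
      rcases mem_φ B x hx with hx | ⟨rfl, -⟩
      · exact (a6 B hB).resolve_left (fun h => lt_irrefl b (h b hbB)) x hx
      · exact absurd rfl hxa
  · intro σ hσ
    rw [mem_filter, mem_ncPartitions] at hσ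
    obtain ⟨⟨a1, a2, a3, a4, a5⟩, B₀, hB₀, haB₀, hbB₀, hmin⟩ := hσ
    rw [hR, mem_ncPartitions]
    refine ⟨⟨?_, ?_, ?_, ?_, ?_⟩, ?_⟩
    · intro B' hB' x hx
      obtain ⟨B, hB, rfl⟩ := mem_image.1 hB'
      obtain ⟨hxa, hx⟩ := mem_erase.1 hx
      exact (mem_insert.1 (a1 B hB hx)).resolve_left hxa
    · intro hE
      obtain ⟨B, hB, hBE⟩ := mem_image.1 hE
      rcases erase_eq_empty_iff _ _ |>.1 hBE with rfl | rfl
      · exact a2 hB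
      · have := a4 _ hB _ hB₀ a (mem_singleton_self _) haB₀
        rw [← this, mem_singleton] at hbB₀
        exact has (hbB₀ ▸ hb)
    · intro x hx
      obtain ⟨B, hB, hxB⟩ := a3 x (mem_insert_of_mem hx)
      exact ⟨B.erase a, mem_image_of_mem _ hB, mem_erase.2 ⟨fun h => has (h ▸ hx), hxB⟩⟩
    · intro B' hB' C' hC' x hx hx'
      obtain ⟨B, hB, rfl⟩ := mem_image.1 hB'
      obtain ⟨C, hC, rfl⟩ := mem_image.1 hC'
      rw [a4 B hB C hC x (mem_of_mem_erase hx) (mem_of_mem_erase hx')]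
    · intro p' hp' q' hq' i j k l hij hjk hkl hi hk hj hl
      obtain ⟨p, hp, rfl⟩ := mem_image.1 hp'
      obtain ⟨q, hq, rfl⟩ := mem_image.1 hq'
      rw [a5 p hp q hq i j k l hij hjk hkl (mem_of_mem_erase hi) (mem_of_mem_erase hk)
        (mem_of_mem_erase hj) (mem_of_mem_erase hl)]
    · intro B' hB'
      obtain ⟨B, hB, rfl⟩ := mem_image.1 hB'
      by_cases haB : a ∈ B
      · obtain rfl := a4 B hB B₀ hB₀ a haB haB₀
        exact Or.inr fun x hx => hmin x (mem_of_mem_erase hx) (ne_of_mem_erase hx)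
      · rw [erase_eq_of_notMem haB]
        have has' : ∀ x ∈ B, a < x := fun x hx =>
          ha x ((mem_insert.1 (a1 B hB hx)).resolve_left fun h => haB (h ▸ hx))
        by_contra! hcon
        obtain ⟨⟨y, hy, hby⟩, x, hx, hxb⟩ := hcon
        rcases hby.eq_or_lt with rfl | hby
        · exact haB (a4 B hB B₀ hB₀ _ hy hbB₀ ▸ haB₀)
        · exact haB (a5 B₀ hB₀ B hB a x b y (has' x hx) hxb hby haB₀ hbB₀ hx hy ▸ haB₀)
  · intro σ hσ
    have hσ := ((hR σ).1 hσ).1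
    ext B
    simp only [mem_image, exists_exists_and_eq_and]
    constructor
    · rintro ⟨C, hC, rfl⟩
      rwa [φ_erase C (hσa σ hσ C hC)]
    · exact fun hB => ⟨B, hB, φ_erase B (hσa σ hσ B hB)⟩
  · intro σ hσ
    rw [mem_filter, mem_ncPartitions] at hσ
    obtain ⟨⟨a1, a2, a3, a4, a5⟩, B₀, hB₀, haB₀, hbB₀, hmin⟩ := hσ
    have hba : b ≠ a := fun h => has (h ▸ hb)
    have key : ∀ B ∈ σ, φ (B.erase a) = B := by
      intro B hB
      by_cases haB : a ∈ B
      · obtain rfl := a4 B hB B₀ hB₀ a haB haB₀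
        simp [φ, hba, hbB₀, insert_erase haB]
      · have hbB : b ∉ B := fun h => haB (a4 B hB B₀ hB₀ b h hbB₀ ▸ haB₀)
        simp [φ, haB, hbB]
    ext B
    simp only [mem_image, exists_exists_and_eq_and]
    constructor
    · rintro ⟨C, hC, rfl⟩
      rwa [key C hC]
    · exact fun hB => ⟨B, hB, key B hB⟩
  · intro σ hσ
    have hσ := ((hR σ).1 hσ).1
    rw [prod_image]
    · refine prod_congr rfl fun B hB => ?_
      rw [hh B (hσa σ hσ B hB)]
      by_cases hbB : b ∈ B
      · simp [φ, hbB]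
      · simp [φ, hbB]
    · intro B hB C hC hBC
      rw [← φ_erase B (hσa σ hσ B hB), ← φ_erase C (hσa σ hσ C hC)]
      exact congrArg (·.erase a) hBC
theorem sum_ncPartitions_insert {R : Type*} [CommSemiring R] (f : Finset (Finset α) → R)
    {a : α} {s : Finset α} (ha : ∀ x ∈ s, a < x) :
    ∑ σ ∈ ncPartitions (insert a s), f σ =
      ∑ σ ∈ (ncPartitions (insert a s)).filter ({a} ∈ ·), f σ +
        ∑ b ∈ s, ∑ σ ∈ (ncPartitions (insert a s)).filter (IsNextInBlock · a b), f σ := by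
  have has : a ∉ s := fun h => lt_irrefl a (ha a h)
  simp only [sum_filter]
  rw [sum_comm, ← sum_add_distrib]
  refine sum_congr rfl fun σ hσ => ?_
  obtain ⟨a1, a2, a3, a4, a5⟩ := mem_ncPartitions.1 hσ
  obtain ⟨B₀, hB₀, haB₀⟩ := a3 a (mem_insert_self _ _)
  have hBs : B₀.erase a ⊆ s := fun x hx =>
    (mem_insert.1 (a1 B₀ hB₀ (mem_of_mem_erase hx))).resolve_left (ne_of_mem_erase hx)
  by_cases hsing : {a} ∈ σ
  · rw [if_pos hsing, sum_eq_zero, add_zero]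
    intro b hb
    refine if_neg ?_
    rintro ⟨B, hB, haB, hbB, -⟩
    have := a4 B hB _ hsing a haB (mem_singleton_self _)
    rw [this, mem_singleton] at hbB
    exact has (hbB ▸ hb)
  · have hne : (B₀.erase a).Nonempty := by
      rw [nonempty_iff_ne_empty]
      intro h
      rcases (erase_eq_empty_iff _ _).1 h with rfl | rfl
      · exact a2 hB₀
      · exact hsing hB₀
    have hmem := min'_mem _ hne
    rw [if_neg hsing, zero_add, sum_eq_single ((B₀.erase a).min' hne), if_pos]
    · exact ⟨B₀, hB₀, haB₀, mem_of_mem_erase hmem,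
        fun x hx hxa => min'_le _ _ (mem_erase.2 ⟨hxa, hx⟩)⟩
    · intro b hb hbne
      refine if_neg ?_
      rintro ⟨B, hB, haB, hbB, hmin⟩
      obtain rfl := a4 B hB B₀ hB₀ a haB haB₀
      have hba : b ≠ a := fun h => has (h ▸ hb)
      exact hbne (le_antisymm (hmin _ (mem_of_mem_erase hmem) (ne_of_mem_erase hmem))
        (min'_le _ _ (mem_erase.2 ⟨hba, hbB⟩)))
    · exact fun h => absurd (hBs hmem) h

theorem sum_card_filter_lt_gt {R : Type*} [AddCommMonoid R] (s : Finset α) (F : ℕ → ℕ → R) :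
    F #s 0 + ∑ b ∈ s, F #(s.filter (· < b)) (#(s.filter (b < ·)) + 1) =
      ∑ p ∈ antidiagonal #s, F p.1 p.2 := by
  induction s using Finset.induction_on_min generalizing F with
  | empty => simp
  | insert a s ha ih =>
    have has : a ∉ s := fun h => lt_irrefl a (ha a h)
    rw [card_insert_of_notMem has, Finset.Nat.sum_antidiagonal_succ, ← ih fun i m => F (i + 1) m,
      sum_insert has]
    have h1 : (insert a s).filter (· < a) = ∅ := by
      rw [filter_eq_empty_iff]
      intro x hx
      rcases mem_insert.1 hx with rfl | hx
      · exact lt_irrefl _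
      · exact (ha x hx).not_gt
    have h2 : (insert a s).filter (a < ·) = s := by
      rw [filter_insert, if_neg (lt_irrefl a), filter_true_of_mem ha]
    rw [h1, h2, card_empty, add_left_comm]
    congr 2
    refine sum_congr rfl fun b hb => ?_
    rw [filter_insert, if_pos (ha b hb), filter_insert, if_neg (ha b hb).not_gt,
      card_insert_of_notMem fun h => has (mem_filter.1 h).1]

/-- Weighted enumeration of noncrossing partitions: `t n 0` is the sum over the noncrossing
partitions of an `n`-element set of the product of the weights `w` of the block sizes. For `n ≥ 1`,
`t n j` is the same sum, except that the size of the block of the least element counts as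
increased by `j`. -/
theorem sum_ncPartitions_prod_card {R : Type*} [CommSemiring R] (w : ℕ → R) (t : ℕ → ℕ → R)
    (hw : w 0 = 1) (ht0 : ∀ j, t 0 j = w j)
    (ht : ∀ n j, t (n + 1) j = ∑ p ∈ antidiagonal n, t p.1 0 * t p.2 (j + 1)) (s : Finset α) :
    ∑ σ ∈ ncPartitions s, ∏ B ∈ σ, w #B = t #s 0 := by
  suffices H : ∀ n, ∀ s : Finset α, #s = n →
      (∑ σ ∈ ncPartitions s, ∏ B ∈ σ, w #B = t n 0) ∧
      ∀ a, (∀ x ∈ s, a < x) → ∀ j, ∑ σ ∈ ncPartitions (insert a s),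
        ∏ B ∈ σ, (if a ∈ B then w (#B + j) else w #B) = t (n + 1) j from (H _ s rfl).1
  intro n
  induction n using Nat.strong_induction_on with
  | _ n ih =>
  intro s hs
  have first : ∑ σ ∈ ncPartitions s, ∏ B ∈ σ, w #B = t n 0 := by
    rcases s.eq_empty_or_nonempty with rfl | hne
    · obtain rfl : 0 = n := by simpa using hs
      simp [ncPartitions_empty, ht0, hw]
    · have hmem := min'_mem s hne
      have hc := card_erase_add_one hmem
      have := (ih _ (by omega) (s.erase (s.min' hne)) rfl).2 (s.min' hne)
        (fun x hx => min'_lt_of_mem_erase_min' _ hne hx) 0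
      simpa [insert_erase hmem, hc, hs] using this
  refine ⟨first, fun a ha j => ?_⟩
  have has : a ∉ s := fun h => lt_irrefl a (ha a h)
  rw [sum_ncPartitions_insert _ ha, sum_ncPartitions_insert_singleton _ ha, ht, ← hs,
    ← sum_card_filter_lt_gt s fun i m => t i 0 * t m (j + 1)]
  congr 1
  · rw [ht0, mul_comm, hs, ← first, if_pos (mem_singleton_self a), card_singleton, add_comm 1 j]
    congr 1
    refine sum_congr rfl fun σ hσ => prod_congr rfl fun B hB => if_neg fun h => ?_
    exact has ((mem_ncPartitions.1 hσ).1 B hB h)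
  · refine sum_congr rfl fun b hb => ?_
    rw [sum_ncPartitions_insert_next _ (fun B => if b ∈ B then w (#B + (j + 1)) else w #B) ha hb]
    · have hlt : #(s.filter (· < b)) < n := hs ▸ card_lt_card
        (filter_ssubset.2 ⟨b, hb, lt_irrefl b⟩)
      have hgt : #(s.filter (b < ·)) < n := hs ▸ card_lt_card
        (filter_ssubset.2 ⟨b, hb, lt_irrefl b⟩)
      have hins : s.filter (b ≤ ·) = insert b (s.filter (b < ·)) := by
        ext x
        simp only [mem_filter, mem_insert, le_iff_eq_or_lt]
        constructor
        · tauto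
        · rintro (rfl | h)
          · exact ⟨hb, Or.inl rfl⟩
          · tauto
      rw [hins, (ih _ hgt _ rfl).2 b (fun x hx => (mem_filter.1 hx).2),
        ← (ih _ hlt _ rfl).1]
      congr 1
      refine sum_congr rfl fun σ hσ => prod_congr rfl fun B hB => if_neg fun h => ?_
      exact lt_irrefl b (mem_filter.1 ((mem_ncPartitions.1 hσ).1 B hB h)).2
    · intro B haB
      have hab : a ≠ b := fun h => has (h ▸ hb)
      by_cases hbB : b ∈ B
      · simp [hbB, haB, add_assoc, add_comm 1 j]
      · simp [hbB, haB]

end NoncrossingFamilies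
section GeneratingFunctions

open PowerSeries

/-- The Catalan generating function with integer coefficients. -/
noncomputable def intCatalanSeries : ℤ⟦X⟧ := map (Nat.castRingHom ℤ) catalanSeries

theorem intCatalanSeries_eq : intCatalanSeries = 1 + X * intCatalanSeries ^ 2 := by
  have := congrArg (map (Nat.castRingHom ℤ)) catalanSeries_sq_mul_X_add_one
  simp only [map_add, map_mul, map_pow, map_X, map_one] at this
  rw [intCatalanSeries]
  linear_combination -this

/-- The free cumulants of the sequence `1, 1, 0, 0, …`. For `n ≥ 1`, the `n`-th one is the Möbius
function of the lattice of noncrossing partitions of an `n`-element set, evaluated at `(⊥, ⊤)`. -/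
def signedCatalan : ℕ → ℤ
  | 0 => 1
  | n + 1 => (-1) ^ n * catalan n

theorem exists_series_signedCatalan : ∃ T : ℕ → ℤ⟦X⟧, T 0 = 1 + X ∧
    ∀ j, T j = C (signedCatalan j) + X * (T 0 * T (j + 1)) := by
  have ha : HasSubst (X * (1 + X) : ℤ⟦X⟧) := HasSubst.of_constantCoeff_zero' (by simp)
  let φ := substAlgHom (R := ℤ) ha
  let W : ℕ → ℤ⟦X⟧ := fun j => mk fun i => signedCatalan (i + j)
  have hφX : φ X = X * (1 + X) := substAlgHom_X ha
  have hφC : ∀ r : ℤ, φ (C r) = C r := fun r => φ.commutes r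
  have hW : ∀ j, W j = C (signedCatalan j) + X * W (j + 1) := by
    intro j
    ext n
    cases n with
    | zero => simp [W]
    | succ n =>
      rw [map_add, coeff_succ_X_mul, coeff_succ_C, zero_add, coeff_mk, coeff_mk, add_right_comm,
        add_assoc]
  have hW1 : W 1 = 1 - X * W 1 ^ 2 := by
    have h1 : W 1 = rescale (-1) intCatalanSeries := by
      ext n
      simp [W, intCatalanSeries, signedCatalan, coeff_rescale]
    have h2 := congrArg (rescale (-1 : ℤ)) intCatalanSeries_eq
    rw [map_add, map_mul, map_pow, map_one, rescale_neg_one_X] at h2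
    rw [h1]
    linear_combination h2
  have hV : φ (W 1) = 1 - X * (1 + X) * φ (W 1) ^ 2 := by
    have := congrArg φ hW1
    rwa [map_sub, map_mul, map_pow, map_one, hφX] at this
  have hunit : (1 + X * (1 + (1 + X) * φ (W 1)) : ℤ⟦X⟧) ≠ 0 := by
    intro h
    simpa using congrArg constantCoeff h
  have hy : (1 + X) * φ (W 1) = 1 := by
    have : ((1 + X) * φ (W 1) - 1) * (1 + X * (1 + (1 + X) * φ (W 1))) = 0 := by
      linear_combination (1 + X) * hV
    exact sub_eq_zero.1 ((mul_eq_zero.1 this).resolve_right hunit)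
  have h0 : φ (W 0) = 1 + X := by
    rw [hW 0, map_add, map_mul, hφX, hφC, zero_add]
    simp only [signedCatalan, map_one]
    linear_combination X * hy
  refine ⟨fun j => φ (W j), h0, fun j => ?_⟩
  simp only [h0]
  conv_lhs => rw [hW j, map_add, map_mul, hφX, hφC]
  ring

theorem sum_ncPartitions_signedCatalan {α : Type*} [LinearOrder α] (s : Finset α) :
    ∑ σ ∈ ncPartitions s, ∏ B ∈ σ, signedCatalan #B = if #s ≤ 1 then 1 else 0 := by
  obtain ⟨T, hT0, hT⟩ := exists_series_signedCatalan
  rw [sum_ncPartitions_prod_card signedCatalan (fun n j => coeff n (T j)) rfl]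
  · simp only [hT0, map_add, coeff_one, coeff_X]
    rcases #s with _ | _ | n <;> simp
  · intro j
    rw [hT]
    simp
  · intro n j
    rw [hT, map_add, coeff_succ_X_mul, coeff_succ_C, zero_add, coeff_mul]

/-- The generating function of the binomial coefficients `(2m + k).choose m`. -/
noncomputable def chooseSeries (k : ℕ) : ℤ⟦X⟧ := mk fun m => ((2 * m + k).choose m : ℤ)

theorem chooseSeries_succ (k : ℕ) :
    chooseSeries (k + 1) = chooseSeries k + X * chooseSeries (k + 2) := by
  ext m
  cases m with
  | zero => simp [chooseSeries]
  | succ m =>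
    rw [map_add, coeff_succ_X_mul, chooseSeries, chooseSeries, chooseSeries, coeff_mk, coeff_mk,
      coeff_mk, show 2 * (m + 1) + (k + 1) = (2 * m + (k + 2)) + 1 by ring,
      Nat.choose_succ_succ, show 2 * (m + 1) + k = 2 * m + (k + 2) by ring]
    push_cast
    ring

theorem chooseSeries_zero : chooseSeries 0 * (2 - intCatalanSeries) = intCatalanSeries := by
  set M := intCatalanSeries with hMdef
  set M' := d⁄dX ℤ M with hM'
  have hM : M = 1 + X * M ^ 2 := intCatalanSeries_eq
  have hB : chooseSeries 0 = M + X * M' := by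
    ext m
    have h : ((m + 1 : ℕ) * catalan m : ℤ) = m.centralBinom := by
      exact_mod_cast succ_mul_catalan_eq_centralBinom m
    have hc : coeff m M = (catalan m : ℤ) := by simp [hMdef, intCatalanSeries]
    rw [map_add, hc, chooseSeries, coeff_mk, add_zero, ← Nat.centralBinom_eq_two_mul_choose, ← h]
    cases m with
    | zero => simp
    | succ m =>
      have hc : coeff (m + 1) M = (catalan (m + 1) : ℤ) := by simp [hMdef, intCatalanSeries]
      rw [coeff_succ_X_mul, hM', coeff_derivative, hc]
      push_cast
      ring
  have hD : M' = M ^ 2 + 2 * X * M * M' := by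
    have := congrArg (d⁄dX ℤ) hM
    rw [map_add, Derivation.leibniz, Derivation.leibniz_pow] at this
    simp only [derivative_X, Derivation.map_one_eq_zero, smul_eq_mul, nsmul_eq_mul] at this
    rw [← hM'] at this
    push_cast at this
    linear_combination this
  have h2 : M * (1 - 2 * X * M) = 2 - M := by linear_combination 2 * hM
  have h3 : M' * (2 - M) = M ^ 3 := by
    rw [← h2]
    linear_combination M * hD
  rw [hB]
  linear_combination X * h3 - M * hM

theorem chooseSeries_mul (k : ℕ) :
    chooseSeries k * (2 - intCatalanSeries) = intCatalanSeries ^ (k + 1) := by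
  have hM := intCatalanSeries_eq
  have hX : (X : ℤ⟦X⟧) ≠ 0 := X_ne_zero
  induction k using Nat.twoStepInduction with
  | zero => rw [chooseSeries_zero, zero_add, pow_one]
  | one =>
    have h : 2 * (X * chooseSeries 1) = chooseSeries 0 - 1 := by
      ext m
      cases m with
      | zero => simp [chooseSeries]
      | succ m =>
        rw [two_mul, map_add, coeff_succ_X_mul, map_sub, coeff_one, if_neg m.succ_ne_zero, sub_zero,
          chooseSeries, chooseSeries, coeff_mk, coeff_mk]
        have h1 : (2 * (m + 1) + 0).choose (m + 1) =
            (2 * m + 1).choose m + (2 * m + 1).choose (m + 1) := Nat.choose_succ_succ _ _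
        rw [h1, ← Nat.choose_symm_half m]
        push_cast
        ring
    have h2X : (2 * X : ℤ⟦X⟧) ≠ 0 := by
      refine mul_ne_zero (fun h2 => ?_) hX
      simpa [map_ofNat] using congrArg constantCoeff h2
    refine mul_left_cancel₀ h2X ?_
    linear_combination (2 - intCatalanSeries) * h + chooseSeries_zero + 2 * hM
  | more k h0 h1 =>
    refine mul_left_cancel₀ hX ?_
    linear_combination -(2 - intCatalanSeries) * chooseSeries_succ k + h1 - h0 +
      intCatalanSeries ^ (k + 1) * hM

theorem exists_series_block_count (k : ℕ) : ∃ T : ℕ → (DualNumber ℤ)⟦X⟧,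
    (∀ n, (coeff n (T 0)).snd = coeff n (X ^ (k + 1) * chooseSeries k)) ∧
    ∀ j, T j = C (1 + if j = k + 1 then DualNumber.eps else 0) + X * (T 0 * T (j + 1)) := by
  set M := intCatalanSeries with hMdef
  have hM : M = 1 + X * M ^ 2 := intCatalanSeries_eq
  have hA : chooseSeries k * (2 - M) = M ^ (k + 1) := chooseSeries_mul k
  let A := X ^ (k + 1) * chooseSeries k
  let N : ℕ → ℤ⟦X⟧ := fun j => (if j ≤ k + 1 then (X * M) ^ (k + 1 - j) else 0) + X * M ^ 2 * A
  have hN0 : N 0 = A := by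
    simp only [N, A, Nat.zero_le, if_true, Nat.sub_zero, mul_pow]
    linear_combination -X ^ (k + 1) * hA - X ^ (k + 1) * chooseSeries k * hM
  have hN : ∀ j, N j = (if j = k + 1 then 1 else 0) + X * (M * N (j + 1) + N 0 * M) := by
    intro j
    rw [hN0]
    simp only [N]
    rcases lt_trichotomy j (k + 1) with h | rfl | h
    · rw [if_pos h.le, if_neg h.ne, if_pos (by omega),
        show k + 1 - j = (k + 1 - (j + 1)) + 1 by omega, pow_succ]
      linear_combination X * M * A * hM
    · rw [if_pos le_rfl, if_pos rfl, if_neg (by omega), Nat.sub_self, pow_zero]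
      linear_combination X * M * A * hM
    · rw [if_neg (by omega), if_neg (by omega), if_neg (by omega)]
      linear_combination X * M * A * hM
  let ψ : ℤ⟦X⟧ →+* (DualNumber ℤ)⟦X⟧ := map (algebraMap ℤ (DualNumber ℤ))
  have hψX : ψ X = X := map_X _
  let E : (DualNumber ℤ)⟦X⟧ := C DualNumber.eps
  have hE : E * E = 0 := by
    rw [← map_mul, DualNumber.eps_mul_eps, map_zero]
  refine ⟨fun j => ψ M + E * ψ (N j), ?_, ?_⟩
  · intro n
    change (coeff n (ψ M + E * ψ (N 0))).snd = coeff n A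
    rw [hN0]
    simp [ψ, E]
  · intro j
    have h1 := congrArg ψ hM
    have h2 := congrArg ψ (hN j)
    simp only [map_add, map_mul, map_pow, hψX, map_one] at h1 h2
    have h3 : (C (1 + if j = k + 1 then DualNumber.eps else 0) : (DualNumber ℤ)⟦X⟧) =
        1 + E * ψ (if j = k + 1 then 1 else 0) := by
      split_ifs <;> simp [E]
    rw [h3]
    linear_combination h1 + E * h2 - X * ψ (N 0) * ψ (N (j + 1)) * hE

theorem prod_one_add_eps {ι : Type*} (s : Finset ι) (p : ι → Prop) [DecidablePred p] :
    ∏ i ∈ s, (1 + if p i then DualNumber.eps else 0 : DualNumber ℤ) =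
      1 + (#(s.filter p) : DualNumber ℤ) * DualNumber.eps := by
  induction s using Finset.induction_on with
  | empty => simp
  | insert i s hi ih =>
    rw [prod_insert hi, ih, filter_insert]
    split_ifs with hp
    · rw [card_insert_of_notMem fun h => hi (mem_filter.1 h).1]
      push_cast
      linear_combination (#(s.filter p) : DualNumber ℤ) * DualNumber.eps_mul_eps (R := ℤ)
    · rw [add_zero, one_mul]

/-- The total number of blocks of size `k + 1` in the noncrossing partitions of `s`. -/
theorem sum_ncPartitions_card_filter {α : Type*} [LinearOrder α] (s : Finset α) (k : ℕ)
    (hk : k + 1 ≤ #s) :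
    ∑ σ ∈ ncPartitions s, #(σ.filter (#· = k + 1)) = (2 * #s - (k + 1) - 1).choose (#s - 1) := by
  obtain ⟨T, hT0, hT⟩ := exists_series_block_count k
  have h := sum_ncPartitions_prod_card
    (fun j => (1 + if j = k + 1 then DualNumber.eps else 0 : DualNumber ℤ))
    (fun n j => coeff n (T j)) (by simp) (fun j => by rw [hT]; simp)
    (fun n j => by rw [hT, map_add, coeff_succ_X_mul, coeff_succ_C, zero_add, coeff_mul]) s
  simp only [prod_one_add_eps] at h
  have h' := congrArg TrivSqZeroExt.snd h
  rw [hT0, coeff_X_pow_mul', if_pos hk, chooseSeries, coeff_mk] at h'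
  have hsymm : (2 * (#s - (k + 1)) + k).choose (#s - (k + 1)) =
      (2 * #s - (k + 1) - 1).choose (#s - 1) := by
    rw [show 2 * #s - (k + 1) - 1 = 2 * (#s - (k + 1)) + k by omega]
    exact Nat.choose_symm_of_eq_add (by omega)
  rw [← hsymm, ← Nat.cast_inj (R := ℤ), ← h']
  simp [TrivSqZeroExt.snd_sum]

end GeneratingFunctions
theorem det_of_le {ι : Type*} [PartialOrder ι] [Fintype ι] [DecidableEq ι] :
    (Matrix.of fun i j : ι => if i ≤ j then (1 : ℤ) else 0).det = 1 := by
  let e : LinearExtension ι ≃ ι := Equiv.refl ι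
  have he : ∀ i j : LinearExtension ι, e i ≤ e j → i ≤ j := fun i j h =>
    (toLinearExtension (α := ι)).monotone h
  have : Fintype (LinearExtension ι) := Fintype.ofEquiv ι e.symm
  rw [← Matrix.det_submatrix_equiv_self e, Matrix.det_of_isUpperTriangular]
  · exact prod_eq_one fun i _ => by simp
  · intro i j hij
    simp only [Matrix.submatrix_apply, Matrix.of_apply]
    exact if_neg fun h => not_le.2 hij (he i j h)

theorem sum_ncPartitions_univ {n : ℕ} {R : Type*} [AddCommMonoid R]
    (f : Finset (Finset (Fin n)) → R) :
    ∑ σ ∈ ncPartitions (univ : Finset (Fin n)), f σ =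
      ∑ π : {π : Finpartition (univ : Finset (Fin n)) // IsNoncrossing π}, f π.1.parts := by
  symm
  refine Finset.sum_bij (fun π _ => π.1.parts) ?_ ?_ ?_ (fun _ _ => rfl)
  · rintro ⟨π, hπ⟩ -
    exact mem_ncPartitions.2 ⟨fun B _ => subset_univ B, π.bot_notMem,
      fun x _ => π.exists_mem (mem_univ x), fun B hB C hC x => π.eq_of_mem_parts hB hC, hπ⟩
  · exact fun π _ π' _ h => Subtype.ext (Finpartition.ext h)
  · intro σ hσ
    obtain ⟨a1, a2, a3, a4, a5⟩ := mem_ncPartitions.1 hσ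
    refine ⟨⟨Finpartition.ofExistsUnique σ a1 (fun x hx => ?_) a2, a5⟩, mem_univ _, rfl⟩
    obtain ⟨B, hB, hxB⟩ := a3 x hx
    exact ⟨B, ⟨hB, hxB⟩, fun C hC => a4 C hC.1 B hB x hC.2 hxB⟩

theorem Finpartition.eq_bot_iff_card_le_one {β : Type*} [DecidableEq β] {s : Finset β}
    (π : Finpartition s) : π = ⊥ ↔ ∀ B ∈ π.parts, #B ≤ 1 := by
  constructor
  · rintro rfl B hB
    obtain ⟨x, -, rfl⟩ := Finpartition.mem_bot_iff.1 hB
    simp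
  · intro h
    refine le_bot_iff.1 fun B hB => ?_
    obtain ⟨x, hx⟩ := π.nonempty_of_mem_parts hB
    refine ⟨{x}, Finpartition.mem_bot_iff.2 ⟨x, π.le hB hx, rfl⟩, ?_⟩
    exact fun y hy => mem_singleton.2 (card_le_one.1 (h B hB) y hy x hx)

/-- The Möbius function of the noncrossing partition lattice sums to `0` over any nontrivial
lower interval. -/
theorem sum_le_prod_signedCatalan {n : ℕ} (π : Finpartition (univ : Finset (Fin n)))
    (hπ : IsNoncrossing π) :
    (∑ σ : {σ : Finpartition (univ : Finset (Fin n)) // IsNoncrossing σ},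
      if σ.1 ≤ π then ∏ B ∈ σ.1.parts, signedCatalan #B else 0) = if π = ⊥ then 1 else 0 := by
  have h := sum_ncRefinements (fun B : Finset (Fin n) => signedCatalan #B) π.parts
    (fun B hB C hC x => π.eq_of_mem_parts hB hC) hπ
  simp only [sum_ncPartitions_signedCatalan] at h
  rw [ncRefinements, sum_filter, π.biUnion_parts, sum_ncPartitions_univ, prod_ite_zero,
    prod_const_one] at h
  simp only [← Finpartition.eq_bot_iff_card_le_one] at h
  convert h
  exact Iff.rfl

theorem IsNoncrossing.inf {n : ℕ} {π π' : Finpartition (univ : Finset (Fin n))}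
    (h : IsNoncrossing π) (h' : IsNoncrossing π') : IsNoncrossing (π ⊓ π') := by
  intro p hp q hq i j k l hij hjk hkl hi hk hj hl
  obtain ⟨p₁, hp₁, hpp₁⟩ := (inf_le_left : π ⊓ π' ≤ π) hp
  obtain ⟨q₁, hq₁, hqq₁⟩ := (inf_le_left : π ⊓ π' ≤ π) hq
  obtain ⟨p₂, hp₂, hpp₂⟩ := (inf_le_right : π ⊓ π' ≤ π') hp
  obtain ⟨q₂, hq₂, hqq₂⟩ := (inf_le_right : π ⊓ π' ≤ π') hq
  have h1 := h p₁ hp₁ q₁ hq₁ i j k l hij hjk hkl (hpp₁ hi) (hpp₁ hk) (hqq₁ hj) (hqq₁ hl)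
  have h2 := h' p₂ hp₂ q₂ hq₂ i j k l hij hjk hkl (hpp₂ hi) (hpp₂ hk) (hqq₂ hj) (hqq₂ hl)
  subst h1 h2
  have hmem : p₁ ∩ p₂ ∈ (π ⊓ π').parts := by
    rw [Finpartition.parts_inf, mem_erase]
    refine ⟨ne_empty_of_mem (mem_inter.2 ⟨hpp₁ hi, hpp₂ hi⟩), ?_⟩
    exact mem_image.2 ⟨(p₁, p₂), mem_product.2 ⟨hp₁, hp₂⟩, rfl⟩
  rw [(π ⊓ π').eq_of_mem_parts hp hmem hi (mem_inter.2 ⟨hpp₁ hi, hpp₂ hi⟩),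
    (π ⊓ π').eq_of_mem_parts hq hmem hj (mem_inter.2 ⟨hqq₁ hj, hqq₂ hj⟩)]

theorem det_incidence_eq_prod (n : ℕ) :
    (Matrix.det (Matrix.of
        fun π π' : {π : Finpartition (univ : Finset (Fin n)) // IsNoncrossing π} =>
          (if π.1 ⊓ π'.1 = ⊥ then 1 else 0 : ℤ))) =
      ∏ π : {π : Finpartition (univ : Finset (Fin n)) // IsNoncrossing π},
        ∏ B ∈ π.1.parts, signedCatalan #B := by
  let Z : Matrix {π : Finpartition (univ : Finset (Fin n)) // IsNoncrossing π}
    {π : Finpartition (univ : Finset (Fin n)) // IsNoncrossing π} ℤ :=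
    Matrix.of fun i j => if i ≤ j then (1 : ℤ) else 0
  have hZ : Z.det = 1 := det_of_le
  have hfac : (Matrix.of
        fun π π' : {π : Finpartition (univ : Finset (Fin n)) // IsNoncrossing π} =>
          (if π.1 ⊓ π'.1 = ⊥ then 1 else 0 : ℤ)) =
      Z.transpose * Matrix.diagonal (fun σ => ∏ B ∈ σ.1.parts, signedCatalan #B) * Z := by
    ext π π'
    rw [Matrix.of_apply, ← sum_le_prod_signedCatalan _ (π.2.inf π'.2), Matrix.mul_apply]
    refine sum_congr rfl fun σ _ => ?_
    rw [Matrix.mul_diagonal, Matrix.transpose_apply]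
    simp only [Z, Matrix.of_apply, le_inf_iff, ← Subtype.coe_le_coe]
    split_ifs <;> simp_all
  rw [hfac, Matrix.det_mul, Matrix.det_mul, Matrix.det_transpose, hZ, Matrix.det_diagonal, one_mul,
    mul_one]

theorem natAbs_signedCatalan (k : ℕ) : (signedCatalan k).natAbs = catalan (k - 1) := by
  cases k with
  | zero => simp [signedCatalan]
  | succ k => simp [signedCatalan, Int.natAbs_mul, Int.natAbs_pow]

/-- **Theorem (determinant of the dual-braid incidence matrix).**  Let `Φₙ` be the matrix
indexed by noncrossing partitions of `{1,…,n}` with entry `1` if `π ⊓ π' = 0ₙ` (the discrete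
partition) and `0` otherwise.  Then
`|det Φₙ| = ∏_{k=2}^{n} Cat_{k-1} ^ C(2n-k-1, n-1)`. -/
theorem natAbs_det_dualBraid_incidence_matrix (n : ℕ) (hn : 1 ≤ n) :
    (Matrix.det (Matrix.of
        fun π π' : {π : Finpartition (univ : Finset (Fin n)) // IsNoncrossing π} =>
          (if π.1 ⊓ π'.1 = ⊥ then 1 else 0 : ℤ))).natAbs =
      ∏ k ∈ Finset.Icc 2 n, catalan (k - 1) ^ Nat.choose (2 * n - k - 1) (n - 1) := by
  have hblocks : ∀ π : {π : Finpartition (univ : Finset (Fin n)) // IsNoncrossing π},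
      ∏ B ∈ π.1.parts, catalan (#B - 1) =
        ∏ k ∈ Finset.Icc 1 n, catalan (k - 1) ^ #(π.1.parts.filter (#· = k)) := by
    intro π
    rw [← prod_fiberwise_of_maps_to (t := Finset.Icc 1 n) (g := fun B => #B)]
    · refine prod_congr rfl fun k _ => ?_
      rw [prod_congr rfl fun B hB => by rw [(mem_filter.1 hB).2], prod_const]
    · intro B hB
      rw [Finset.mem_Icc]
      exact ⟨card_pos.2 (π.1.nonempty_of_mem_parts hB), card_finset_fin_le B⟩
  rw [det_incidence_eq_prod, ← Int.natAbsHom_apply, map_prod]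
  simp only [map_prod, Int.natAbsHom_apply, natAbs_signedCatalan, hblocks]
  rw [prod_comm, ← prod_subset (Finset.Icc_subset_Icc_left one_le_two)]
  · refine prod_congr rfl fun k hk => ?_
    obtain ⟨hk2, hkn⟩ := Finset.mem_Icc.1 hk
    obtain ⟨m, rfl⟩ : ∃ m, k = m + 1 := ⟨k - 1, by omega⟩
    have h := sum_ncPartitions_card_filter (univ : Finset (Fin n)) m (by simpa using hkn)
    rw [sum_ncPartitions_univ, card_univ, Fintype.card_fin] at h
    rw [prod_pow_eq_pow_sum, h]
  · intro k hk hk2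
    obtain rfl : k = 1 := by
      simp only [Finset.mem_Icc] at hk hk2
      omega
    simp
end

section
/- For 1 ≤ k ≤ n, the total number of blocks of size k counted over all noncrossing partitions of {1,…,n}, that is a_{k,n} = Σ_{π ∈ NC(n)} p_k(π) where p_k(π) is the number of blocks of π having exactly k elements, equals the binomial coefficient binom(2n-k-1, n-1). -/
open Finset
open scoped Classical

/-- The height after `m` steps of the lattice path whose `j`-th step is `F j - 1`. -/
def pathHeight (F : ℕ → ℕ) (m : ℕ) : ℤ := ∑ j ∈ range m, ((F j : ℤ) - 1)

lemma pathHeight_succ (F : ℕ → ℕ) (m : ℕ) :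
    pathHeight F (m + 1) = pathHeight F m + F m - 1 := by
  simp only [pathHeight, sum_range_succ]; ring

lemma pathHeight_eq (F : ℕ → ℕ) (m : ℕ) :
    pathHeight F m = ((∑ j ∈ range m, F j : ℕ) : ℤ) - m := by
  simp [pathHeight, sum_sub_distrib]

/-- The Łukasiewicz paths of length `n`, recorded by their step sizes plus one. -/
noncomputable def lukasiewicz (n : ℕ) : Finset (ℕ → ℕ) :=
  (piAntidiag (range n) n).filter fun F => ∀ m ≤ n, 0 ≤ pathHeight F m

lemma mem_lukasiewicz {n : ℕ} {F : ℕ → ℕ} :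
    F ∈ lukasiewicz n ↔
      ∑ j ∈ range n, F j = n ∧ (∀ j, n ≤ j → F j = 0) ∧ ∀ m ≤ n, 0 ≤ pathHeight F m := by
  simp only [lukasiewicz, mem_filter, mem_piAntidiag, mem_range, and_assoc]
  refine and_congr_right fun _ => and_congr_left fun _ => forall_congr' fun j => ?_
  rw [not_imp_comm, not_lt]

/-! ### Noncrossing maps -/

/-- The maps sending each point to the minimum of its block in a noncrossing partition. -/
structure IsNoncrossingMap {n : ℕ} (m : Fin n → Fin n) : Prop where
  le : ∀ x, m x ≤ x
  idem : ∀ x, m (m x) = m x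
  noncrossing : ∀ i j k l, i < j → j < k → k < l → m i = m k → m j = m l → m i = m j

/-- The number of points sent to `i` by `m`. -/
def fiberCard {n : ℕ} (m : Fin n → Fin n) (i : ℕ) : ℕ := #{x | (m x : ℕ) = i}

lemma pathHeight_fiberCard {n : ℕ} (m : Fin n → Fin n) {a : ℕ} (ha : a ≤ n) :
    pathHeight (fiberCard m) a = (#{x | (m x : ℕ) < a} : ℤ) - #{x : Fin n | (x : ℕ) < a} := by
  have h1 : ∑ j ∈ range a, fiberCard m j = #{x | (m x : ℕ) < a} := by
    rw [card_eq_sum_card_fiberwise (f := fun x => (m x : ℕ)) (t := range a)]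
    · refine sum_congr rfl fun j hj => ?_
      rw [fiberCard, filter_filter]
      congr 1
      ext x
      simp only [mem_filter, mem_univ, true_and, mem_range] at hj ⊢
      omega
    · intro x hx
      simpa using hx
  have h2 : #{x : Fin n | (x : ℕ) < a} = a := by
    rw [Fin.card_filter_val_lt, min_eq_right ha]
  rw [pathHeight_eq, h1, h2]

lemma pathHeight_fiberCard_sub {n : ℕ} (m : Fin n → Fin n) {a b : ℕ} (hab : a ≤ b) (hb : b ≤ n) :
    pathHeight (fiberCard m) b - pathHeight (fiberCard m) a =
      (#{x | a ≤ (m x : ℕ) ∧ (m x : ℕ) < b} : ℤ) - #{x : Fin n | a ≤ (x : ℕ) ∧ (x : ℕ) < b} := by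
  have key (g : Fin n → ℕ) : #{x | g x < b} = #{x | g x < a} + #{x | a ≤ g x ∧ g x < b} := by
    rw [← card_union_of_disjoint]
    · congr 1
      ext x
      simp only [mem_filter, mem_univ, true_and, mem_union]
      omega
    · rw [disjoint_left]
      intro x
      simp only [mem_filter, mem_univ, true_and]
      omega
  rw [pathHeight_fiberCard m hb, pathHeight_fiberCard m (hab.trans hb), key (fun x => (m x : ℕ)),
    key (fun x => (x : ℕ))]
  push_cast
  ring

/-- `i` is the last index at most `y` where the path `F` is not above its height after step `y`. -/
structure IsOpener (F : ℕ → ℕ) (y i : ℕ) : Prop where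
  le : i ≤ y
  height_le : pathHeight F i ≤ pathHeight F (y + 1)
  lt_height : ∀ j, i < j → j ≤ y → pathHeight F (y + 1) < pathHeight F j

lemma IsOpener.unique {F : ℕ → ℕ} {y i i' : ℕ} (h : IsOpener F y i) (h' : IsOpener F y i') :
    i = i' := by
  by_contra hne
  rcases lt_or_gt_of_ne hne with hlt | hlt
  · exact absurd (h.lt_height _ hlt h'.le) (not_lt.2 h'.height_le)
  · exact absurd (h'.lt_height _ hlt h.le) (not_lt.2 h.height_le)

lemma exists_isOpener {F : ℕ → ℕ} {y : ℕ} (h : 0 ≤ pathHeight F (y + 1)) :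
    ∃ i, IsOpener F y i := by
  let i := Nat.findGreatest (fun i => pathHeight F i ≤ pathHeight F (y + 1)) y
  refine ⟨i, Nat.findGreatest_le y, ?_, fun j hij hj => ?_⟩
  · exact Nat.findGreatest_spec (P := fun i => pathHeight F i ≤ pathHeight F (y + 1))
      (Nat.zero_le y) (by simpa [pathHeight] using h)
  · exact not_le.1 (Nat.findGreatest_is_greatest hij hj)

lemma IsNoncrossingMap.isOpener {n : ℕ} {m : Fin n → Fin n} (hm : IsNoncrossingMap m)
    (y : Fin n) : IsOpener (fiberCard m) y (m y) := by
  have hle := hm.le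
  have hid := hm.idem
  refine ⟨hm.le y, ?_, fun j hij hj => ?_⟩
  · have h := pathHeight_fiberCard_sub m (a := m y) (b := y + 1)
      (by have := hm.le y; omega) y.2
    have hsub : #{x : Fin n | (m y : ℕ) ≤ x ∧ (x : ℕ) < y + 1} ≤
        #{x | (m y : ℕ) ≤ m x ∧ (m x : ℕ) < y + 1} := by
      refine card_le_card fun x => ?_
      simp only [mem_filter, mem_univ, true_and]
      rintro ⟨h1, h2⟩
      refine ⟨?_, by have := hm.le x; omega⟩
      by_contra hlt
      have hxy : x ≠ y := by rintro rfl; exact hlt le_rfl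
      have hxi : x ≠ m y := by
        rintro rfl; rw [hid] at hlt; exact hlt le_rfl
      have := hm.noncrossing (m x) (m y) x y (by omega) (by omega) (by omega)
        (hid x) (hid y)
      rw [hid, hid] at this
      rw [this] at hlt
      exact hlt le_rfl
    omega
  · have h := pathHeight_fiberCard_sub m (a := j) (b := y + 1) (by omega) y.2
    have hsub : #{x | j ≤ (m x : ℕ) ∧ (m x : ℕ) < y + 1} <
        #{x : Fin n | j ≤ (x : ℕ) ∧ (x : ℕ) < y + 1} := by
      refine card_lt_card ((ssubset_iff_of_subset fun x => ?_).2 ⟨y, ?_, ?_⟩)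
      · simp only [mem_filter, mem_univ, true_and]
        rintro ⟨h1, h2⟩
        refine ⟨by have := hm.le x; omega, ?_⟩
        by_contra hlt
        have hxy : m x ≠ y := by
          intro hxy
          have := hid x
          rw [hxy] at this
          rw [this] at hij
          omega
        have := hm.noncrossing (m y) (m x) y x (by omega) (by omega) (by omega)
          (hid y) (hid x)
        rw [hid, hid] at this
        rw [this] at hij
        omega
      · simp only [mem_filter, mem_univ, true_and]
        omega
      · simp only [mem_filter, mem_univ, true_and]
        omega
    omega

lemma IsNoncrossingMap.fiberCard_injective {n : ℕ} {m m' : Fin n → Fin n}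
    (hm : IsNoncrossingMap m) (hm' : IsNoncrossingMap m') (h : fiberCard m = fiberCard m') :
    m = m' :=
  funext fun y => Fin.ext ((hm.isOpener y).unique (h ▸ hm'.isOpener y))

lemma IsNoncrossingMap.fiberCard_mem {n : ℕ} {m : Fin n → Fin n} (hm : IsNoncrossingMap m) :
    fiberCard m ∈ lukasiewicz n := by
  have key : ∀ a ≤ n, 0 ≤ pathHeight (fiberCard m) a := by
    intro a ha
    rw [pathHeight_fiberCard m ha, sub_nonneg, Nat.cast_le]
    refine card_le_card fun x => ?_
    simp only [mem_filter, mem_univ, true_and]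
    have := hm.le x
    omega
  refine mem_lukasiewicz.2 ⟨?_, fun j hj => ?_, key⟩
  · have h := pathHeight_fiberCard m le_rfl
    rw [pathHeight_eq] at h
    simp only [Fin.is_lt, filter_true] at h
    omega
  · rw [fiberCard, card_eq_zero, filter_eq_empty_iff]
    intro x _
    omega

lemma exists_isNoncrossingMap {n : ℕ} {F : ℕ → ℕ} (hF : F ∈ lukasiewicz n) :
    ∃ m : Fin n → Fin n, IsNoncrossingMap m ∧ fiberCard m = F := by
  obtain ⟨hsum, hzero, hpos⟩ := mem_lukasiewicz.1 hF
  have hex (y : Fin n) : ∃ i : Fin n, IsOpener F y i := by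
    obtain ⟨i, hi⟩ := exists_isOpener (hpos (y + 1) y.2)
    exact ⟨⟨i, hi.le.trans_lt y.2⟩, hi⟩
  choose m hm using hex
  have hle (x) : m x ≤ x := (hm x).le
  have hnc : IsNoncrossingMap m := by
    refine ⟨hle, fun x => ?_, fun i j k l hij hjk hkl hik hjl => ?_⟩
    · refine Fin.ext ((hm (m x)).unique ⟨le_rfl, ?_, fun j h1 h2 => by omega⟩)
      have h1 := (hm x).height_le
      rcases (hle x).eq_or_lt with h | h
      · rwa [h] at h1 ⊢
      · have := (hm x).lt_height (m x + 1) (by omega) (by omega)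
        omega
    · have hi := hle i
      have hj := hle j
      by_contra hne
      rcases lt_or_gt_of_ne hne with hlt | hlt
      · have h1 := (hm k).lt_height (m j) (by rw [← hik]; exact hlt) (by omega)
        have h2 := (hm l).lt_height (k + 1) (by rw [← hjl]; omega) (by omega)
        have h3 := (hm l).height_le
        rw [← hjl] at h3
        omega
      · have h1 := (hm j).lt_height (m i) hlt (by omega)
        have h2 := (hm k).lt_height (j + 1) (by rw [← hik]; omega) (by omega)
        have h3 := (hm k).height_le
        rw [← hik] at h3
        omega
  refine ⟨m, hnc, ?_⟩
  have hfib (i : ℕ) : fiberCard m i ≤ F i := by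
    have : #{x | (m x : ℕ) = i} ≤ #(Ico (pathHeight F i) (pathHeight F i + F i)) := by
      refine card_le_card_of_injOn (fun x => pathHeight F (x + 1)) ?_ ?_
      · intro x hx
        simp only [coe_filter, mem_univ, true_and, Set.mem_ofPred_eq] at hx
        subst hx
        have h1 := (hm x).height_le
        have h2 := pathHeight_succ F (m x)
        simp only [coe_Ico, Set.mem_Ico]
        refine ⟨h1, ?_⟩
        rcases (hle x).eq_or_lt with h | h
        · rw [h] at h1 h2 ⊢
          omega
        · have := (hm x).lt_height (m x + 1) (by omega) (by omega)
          omega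
      · have hlt (x y : Fin n) (hxy : x < y) (h : m x = m y) :
            pathHeight F (y + 1) < pathHeight F (x + 1) :=
          (hm y).lt_height _ (by have := hle x; rw [← h]; omega) (by omega)
        intro x hx y hy hxy
        simp only [coe_filter, mem_univ, true_and, Set.mem_ofPred_eq] at hx hy
        have h : m x = m y := Fin.ext (hx.trans hy.symm)
        by_contra hne
        rcases lt_or_gt_of_ne hne with hl | hl
        · exact absurd hxy (hlt x y hl h).ne'
        · exact absurd hxy (hlt y x hl h.symm).ne
    simpa [fiberCard] using this
  have htot : ∑ i ∈ range n, fiberCard m i = ∑ i ∈ range n, F i := by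
    rw [hsum, (mem_lukasiewicz.1 hnc.fiberCard_mem).1]
  have heq := (sum_eq_sum_iff_of_le fun i _ => hfib i).1 htot
  ext i
  rcases lt_or_ge i n with h | h
  · exact heq i (mem_range.2 h)
  · rw [hzero i h, (mem_lukasiewicz.1 hnc.fiberCard_mem).2.1 i h]

/-! ### The minimum map of a partition -/

namespace Finpartition

variable {n : ℕ} (π : Finpartition (univ : Finset (Fin n)))

/-- The minimum of the block containing `x`. -/
noncomputable def blockMin (x : Fin n) : Fin n :=
  (π.part x).min' (π.part_nonempty.2 (mem_univ x))

lemma blockMin_mem (x : Fin n) : π.blockMin x ∈ π.part x := min'_mem _ _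

lemma blockMin_le_of_mem {x y : Fin n} (h : y ∈ π.part x) : π.blockMin x ≤ y := min'_le _ _ h

lemma part_blockMin (x : Fin n) : π.part (π.blockMin x) = π.part x :=
  π.part_eq_of_mem (π.part_mem.2 (mem_univ x)) (π.blockMin_mem x)

lemma blockMin_eq_iff {x y : Fin n} : π.blockMin x = π.blockMin y ↔ π.part x = π.part y := by
  refine ⟨fun h => ?_, fun h => ?_⟩
  · rw [← π.part_blockMin x, h, π.part_blockMin]
  · simp only [blockMin, h]

lemma mem_part_iff_blockMin_eq {x y : Fin n} : y ∈ π.part x ↔ π.blockMin y = π.blockMin x := by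
  rw [blockMin_eq_iff, π.mem_part_iff_part_eq_part (mem_univ _) (mem_univ _)]

lemma blockMin_blockMin (x : Fin n) : π.blockMin (π.blockMin x) = π.blockMin x :=
  π.blockMin_eq_iff.2 (π.part_blockMin x)

lemma isNoncrossingMap_blockMin (h : IsNoncrossing π) : IsNoncrossingMap π.blockMin := by
  refine ⟨fun x => π.blockMin_le_of_mem (π.mem_part (mem_univ x)), π.blockMin_blockMin,
    fun i j k l hij hjk hkl hik hjl => π.blockMin_eq_iff.2 ?_⟩
  exact h _ (π.part_mem.2 (mem_univ i)) _ (π.part_mem.2 (mem_univ j)) i j k l hij hjk hkl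
    (π.mem_part (mem_univ i)) (π.mem_part_iff_blockMin_eq.2 hik.symm)
    (π.mem_part (mem_univ j)) (π.mem_part_iff_blockMin_eq.2 hjl.symm)

lemma isNoncrossing_of_blockMin (h : IsNoncrossingMap π.blockMin) : IsNoncrossing π := by
  intro p hp q hq i j k l hij hjk hkl hi hk hj hl
  rw [← π.part_eq_of_mem hp hi, ← π.part_eq_of_mem hq hj, ← blockMin_eq_iff]
  refine h.noncrossing i j k l hij hjk hkl (π.blockMin_eq_iff.2 ?_) (π.blockMin_eq_iff.2 ?_)
  · rw [π.part_eq_of_mem hp hi, π.part_eq_of_mem hp hk]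
  · rw [π.part_eq_of_mem hq hj, π.part_eq_of_mem hq hl]

lemma parts_eq_image_part : π.parts = univ.image π.part := by
  ext p
  simp only [mem_image, mem_univ, true_and]
  constructor
  · intro hp
    obtain ⟨x, hx⟩ := π.nonempty_of_mem_parts hp
    exact ⟨x, π.part_eq_of_mem hp hx⟩
  · rintro ⟨x, rfl⟩
    exact π.part_mem.2 (mem_univ x)

lemma blockMin_injective : Function.Injective (blockMin (n := n)) := by
  intro π π' h
  have hpart : π.part = π'.part := by
    funext x
    ext y
    rw [mem_part_iff_blockMin_eq, mem_part_iff_blockMin_eq, h]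
  ext1
  rw [parts_eq_image_part, parts_eq_image_part, hpart]

lemma exists_blockMin_eq {m : Fin n → Fin n} (hm : IsNoncrossingMap m) :
    ∃ π : Finpartition (univ : Finset (Fin n)), π.blockMin = m := by
  refine ⟨ofSetoid (Setoid.ker m), funext fun x => le_antisymm ?_ ?_⟩
  · refine blockMin_le_of_mem _ (mem_part_ofSetoid_iff_rel.2 ?_)
    exact (hm.idem x).symm
  · have h : m x = m _ := mem_part_ofSetoid_iff_rel.1 (blockMin_mem (ofSetoid (Setoid.ker m)) x)
    rw [h]
    exact hm.le _

lemma card_parts_filter_card_eq {k : ℕ} (hk : 1 ≤ k) :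
    #{p ∈ π.parts | #p = k} = #{i ∈ range n | fiberCard π.blockMin i = k} := by
  have hcard (x : Fin n) : fiberCard π.blockMin (π.blockMin x) = #(π.part x) := by
    rw [fiberCard]
    congr 1
    ext y
    simp [mem_part_iff_blockMin_eq, Fin.ext_iff]
  symm
  refine card_bij' (fun i _ => if h : i < n then π.part ⟨i, h⟩ else ∅)
    (fun p _ => if h : p.Nonempty then (p.min' h : ℕ) else 0) ?_ ?_ ?_ ?_
  · intro i hi
    simp only [mem_filter, mem_range] at hi ⊢
    obtain ⟨hin, hik⟩ := hi
    obtain ⟨x, hx⟩ : (univ.filter fun x => (π.blockMin x : ℕ) = i).Nonempty := by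
      rw [← card_pos]; change 0 < fiberCard π.blockMin i; omega
    simp only [mem_filter, mem_univ, true_and] at hx
    subst hx
    rw [dif_pos hin]
    exact ⟨π.part_mem.2 (mem_univ _), by rw [part_blockMin, ← hcard, hik]⟩
  · intro p hp
    simp only [mem_filter, mem_range] at hp ⊢
    obtain ⟨hp, hpk⟩ := hp
    obtain ⟨x, hx⟩ := π.nonempty_of_mem_parts hp
    obtain rfl := π.part_eq_of_mem hp hx
    rw [dif_pos ⟨x, hx⟩]
    exact ⟨Fin.is_lt _, (hcard x).trans hpk⟩
  · intro i hi
    simp only [mem_filter, mem_range] at hi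
    obtain ⟨hin, hik⟩ := hi
    obtain ⟨x, hx⟩ : (univ.filter fun x => (π.blockMin x : ℕ) = i).Nonempty := by
      rw [← card_pos]; change 0 < fiberCard π.blockMin i; omega
    simp only [mem_filter, mem_univ, true_and] at hx
    subst hx
    simp only [Fin.is_lt, dite_true, Fin.eta, part_nonempty, mem_univ]
    exact congrArg Fin.val (π.blockMin_blockMin x)
  · intro p hp
    simp only [mem_filter] at hp
    obtain ⟨hp, hpk⟩ := hp
    obtain ⟨x, hx⟩ := π.nonempty_of_mem_parts hp
    obtain rfl := π.part_eq_of_mem hp hx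
    have hne : (π.part x).Nonempty := ⟨x, hx⟩
    simp only [hne, dite_true, Fin.is_lt, Fin.eta]
    exact π.part_blockMin x

end Finpartition

lemma sum_noncrossing_eq_sum_lukasiewicz (n k : ℕ) (hk : 1 ≤ k) :
    (∑ π ∈ (univ : Finset (Finpartition (univ : Finset (Fin n)))).filter IsNoncrossing,
      (π.parts.filter fun p => p.card = k).card) =
    ∑ F ∈ lukasiewicz n, #{i ∈ range n | F i = k} := by
  refine sum_bij (fun π _ => fiberCard π.blockMin) ?_ ?_ ?_ ?_
  · intro π hπ
    exact (π.isNoncrossingMap_blockMin (mem_filter.1 hπ).2).fiberCard_mem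
  · intro π hπ π' hπ' h
    exact Finpartition.blockMin_injective
      ((π.isNoncrossingMap_blockMin (mem_filter.1 hπ).2).fiberCard_injective
        (π'.isNoncrossingMap_blockMin (mem_filter.1 hπ').2) h)
  · intro F hF
    obtain ⟨m, hm, rfl⟩ := exists_isNoncrossingMap hF
    obtain ⟨π, rfl⟩ := Finpartition.exists_blockMin_eq hm
    exact ⟨π, mem_filter.2 ⟨mem_univ _, π.isNoncrossing_of_blockMin hm⟩, rfl⟩
  · intro π _
    exact π.card_parts_filter_card_eq hk

/-! ### The cycle lemma -/

section Cycle

variable {n : ℕ}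

/-- The function on `ℕ` obtained by reading `g` cyclically, starting from `r`. -/
def cyclicRead (g : ZMod (n + 1) → ℕ) (r : ZMod (n + 1)) (j : ℕ) : ℕ := g (r + j)

lemma sum_range_natCast_zmod (g : ZMod (n + 1) → ℕ) :
    ∑ j ∈ range (n + 1), g (j : ZMod (n + 1)) = ∑ x, g x := by
  refine sum_bij' (fun j _ => (j : ZMod (n + 1))) (fun x _ => x.val) ?_ ?_ ?_ ?_ ?_
  · simp
  · intro x _
    exact mem_range.2 (ZMod.val_lt x)
  · intro j hj
    exact ZMod.val_cast_of_lt (mem_range.1 hj)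
  · intro x _
    exact ZMod.natCast_zmod_val x
  · simp

lemma sum_range_cyclicRead (g : ZMod (n + 1) → ℕ) (r : ZMod (n + 1)) :
    ∑ j ∈ range (n + 1), cyclicRead g r j = ∑ x, g x := by
  rw [← Equiv.sum_comp (Equiv.addLeft r) g, ← sum_range_natCast_zmod]
  rfl

lemma pathHeight_cyclicRead (g : ZMod (n + 1) → ℕ) (a m : ℕ) :
    pathHeight (cyclicRead g a) m =
      pathHeight (cyclicRead g 0) (a + m) - pathHeight (cyclicRead g 0) a := by
  simp only [pathHeight, sum_range_add, add_sub_cancel_left, cyclicRead, zero_add, Nat.cast_add]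

lemma pathHeight_cyclicRead_add_period {g : ZMod (n + 1) → ℕ} (hg : ∑ x, g x = n) (a : ℕ) :
    pathHeight (cyclicRead g 0) (a + (n + 1)) = pathHeight (cyclicRead g 0) a - 1 := by
  have h := pathHeight_cyclicRead g a (n + 1)
  rw [pathHeight_eq, sum_range_cyclicRead, hg] at h
  push_cast at h
  linarith

lemma exists_start_nonneg {g : ZMod (n + 1) → ℕ} (hg : ∑ x, g x = n) :
    ∃ r, ∀ m ≤ n, 0 ≤ pathHeight (cyclicRead g r) m := by
  set H := pathHeight (cyclicRead g 0) with hH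
  have hex : ∃ a, a < n + 1 ∧ ∀ b < n + 1, H a ≤ H b := by
    obtain ⟨a, ha, hab⟩ := exists_min_image (range (n + 1)) H ⟨0, by simp⟩
    exact ⟨a, mem_range.1 ha, fun b hb => hab b (mem_range.2 hb)⟩
  obtain ⟨ha, hmin⟩ := Nat.find_spec hex
  set a := Nat.find hex with ha_def
  refine ⟨(a : ZMod (n + 1)), fun m hm => ?_⟩
  rw [pathHeight_cyclicRead, sub_nonneg, ← hH]
  rcases lt_or_ge (a + m) (n + 1) with h | h
  · exact hmin _ h
  · obtain ⟨b, hb⟩ := Nat.exists_eq_add_of_le' h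
    have hba : b < a := by omega
    have hnot := Nat.find_min hex hba
    have hlt : H a < H b := by
      refine lt_of_le_of_ne (hmin b (by omega)) fun heq => hnot ⟨by omega, fun c hc => ?_⟩
      exact heq ▸ hmin c hc
    have := pathHeight_cyclicRead_add_period hg b
    rw [hb, hH, this, ← hH]
    omega

lemma start_nonneg_unique {g : ZMod (n + 1) → ℕ} (hg : ∑ x, g x = n) {r s : ZMod (n + 1)}
    (hr : ∀ m ≤ n, 0 ≤ pathHeight (cyclicRead g r) m)
    (hs : ∀ m ≤ n, 0 ≤ pathHeight (cyclicRead g s) m) : r = s := by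
  have key : ∀ a b : ℕ, a < b → b < n + 1 →
      (∀ m ≤ n, 0 ≤ pathHeight (cyclicRead g (a : ZMod (n + 1))) m) →
      ¬ ∀ m ≤ n, 0 ≤ pathHeight (cyclicRead g (b : ZMod (n + 1))) m := by
    intro a b hab hb h1 h2
    have h3 := h1 (b - a) (by omega)
    have h4 := h2 (a + (n + 1) - b) (by omega)
    rw [pathHeight_cyclicRead, Nat.add_sub_cancel' hab.le] at h3
    rw [pathHeight_cyclicRead, Nat.add_sub_cancel' (by omega),
      pathHeight_cyclicRead_add_period hg] at h4
    omega
  rw [← ZMod.natCast_zmod_val r] at hr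
  rw [← ZMod.natCast_zmod_val s] at hs
  by_contra hne
  have hne' : r.val ≠ s.val := fun h => hne (ZMod.val_injective _ h)
  rcases lt_or_gt_of_ne hne' with h | h
  · exact key _ _ h (ZMod.val_lt s) hr hs
  · exact key _ _ h (ZMod.val_lt r) hs hr

lemma sum_lukasiewicz_eq_card {k : ℕ} (hk : 1 ≤ k) :
    ∑ F ∈ lukasiewicz n, #{i ∈ range n | F i = k} =
      #{g ∈ piAntidiag (univ : Finset (ZMod (n + 1))) n | g 0 = k} := by
  rw [← card_sigma]
  have hread : ∀ (F : ℕ → ℕ) (i m : ℕ), m ≤ n + 1 →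
      pathHeight (cyclicRead (fun x : ZMod (n + 1) => F (x + i).val) (-i : ZMod (n + 1))) m =
        pathHeight F m := by
    intro F i m hm
    refine sum_congr rfl fun j hj => ?_
    have hj := mem_range.1 hj
    rw [cyclicRead, neg_add_cancel_comm, ZMod.val_cast_of_lt (by omega)]
  have hsum : ∀ F ∈ lukasiewicz n, ∀ i : ℕ, ∑ x : ZMod (n + 1), F (x + i).val = n := by
    intro F hF i
    obtain ⟨h1, h2, -⟩ := mem_lukasiewicz.1 hF
    refine (Equiv.sum_comp (Equiv.addRight (i : ZMod (n + 1))) (fun x => F x.val)).trans ?_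
    rw [← sum_range_natCast_zmod, sum_range_succ, ZMod.val_cast_of_lt (by omega), h2 n le_rfl,
      add_zero]
    refine (sum_congr rfl fun j hj => ?_).trans h1
    rw [ZMod.val_cast_of_lt (by have := mem_range.1 hj; omega)]
  refine card_bij (fun p _ x => p.1 (x + (p.2 : ZMod (n + 1))).val) ?_ ?_ ?_
  · rintro ⟨F, i⟩ hp
    simp only [mem_sigma, mem_filter, mem_range] at hp
    obtain ⟨hF, hi, hik⟩ := hp
    simp only [mem_filter, mem_piAntidiag, mem_univ, implies_true, and_true, zero_add]
    refine ⟨hsum F hF i, ?_⟩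
    rw [ZMod.val_cast_of_lt (by omega), hik]
  · rintro ⟨F, i⟩ hp ⟨F', i'⟩ hp' h
    simp only [mem_sigma, mem_filter, mem_range] at hp hp'
    obtain ⟨hF, hi, -⟩ := hp
    obtain ⟨hF', hi', -⟩ := hp'
    dsimp only at h
    have hii : (-i : ZMod (n + 1)) = -i' := by
      refine start_nonneg_unique (hsum F hF i) (fun m hm => ?_) (fun m hm => ?_)
      · rw [hread F i m (by omega)]
        exact (mem_lukasiewicz.1 hF).2.2 m hm
      · rw [h, hread F' i' m (by omega)]
        exact (mem_lukasiewicz.1 hF').2.2 m hm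
    have hii' : i = i' := by
      have := congrArg ZMod.val (neg_injective hii)
      rwa [ZMod.val_cast_of_lt (by omega), ZMod.val_cast_of_lt (by omega)] at this
    subst hii'
    have hFF : F = F' := by
      ext j
      rcases lt_or_ge j n with hj | hj
      · have := congrFun h (j - i)
        simpa only [sub_add_cancel, ZMod.val_cast_of_lt (show j < n + 1 by omega)] using this
      · rw [(mem_lukasiewicz.1 hF).2.1 j hj, (mem_lukasiewicz.1 hF').2.1 j hj]
    rw [hFF]
  · intro g hg
    simp only [mem_filter, mem_piAntidiag, mem_univ, implies_true, and_true] at hg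
    obtain ⟨hg, hgk⟩ := hg
    obtain ⟨r, hr⟩ := exists_start_nonneg hg
    set F : ℕ → ℕ := fun j => if j < n + 1 then cyclicRead g r j else 0 with hF
    have hlt (j : ℕ) (hj : j < n + 1) : F j = cyclicRead g r j := if_pos hj
    have htot := sum_range_cyclicRead g r
    have hn := hr n le_rfl
    rw [hg, sum_range_succ] at htot
    rw [pathHeight_eq] at hn
    have hlast : cyclicRead g r n = 0 := by omega
    have hmem : F ∈ lukasiewicz n := by
      refine mem_lukasiewicz.2 ⟨?_, fun j hj => ?_, fun m hm => ?_⟩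
      · rw [sum_congr rfl fun j hj => hlt j (by have := mem_range.1 hj; omega)]
        change ∑ j ∈ range n, cyclicRead g r j = n
        omega
      · rcases hj.eq_or_lt with rfl | hj
        · rw [hlt _ (by omega), hlast]
        · exact if_neg (by omega)
      · refine (hr m hm).trans_eq (sum_congr rfl fun j hj => ?_)
        rw [hlt _ (by have := mem_range.1 hj; omega)]
    have hFr : F (-r).val = k := by
      rw [hlt _ (ZMod.val_lt _), cyclicRead, ZMod.natCast_zmod_val, add_neg_cancel, hgk]
    refine ⟨⟨F, (-r).val⟩, ?_, ?_⟩
    · simp only [mem_sigma, mem_filter, mem_range]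
      refine ⟨hmem, ?_, hFr⟩
      by_contra h
      rw [(mem_lukasiewicz.1 hmem).2.1 _ (not_lt.1 h)] at hFr
      omega
    · funext x
      dsimp only
      rw [hlt _ (ZMod.val_lt _), cyclicRead, ZMod.natCast_zmod_val, ZMod.natCast_zmod_val]
      congr 1
      abel

end Cycle

lemma card_piAntidiag_nat {α : Type*} [DecidableEq α] (s : Finset α) (N : ℕ) :
    #(piAntidiag s N) = (#s + N - 1).choose N := by
  rw [← card_finsuppAntidiag_nat_eq_choose]
  symm
  refine card_bij (fun f _ => ⇑f) ?_ ?_ ?_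
  · intro f hf
    simp only [mem_finsuppAntidiag, mem_piAntidiag] at hf ⊢
    exact ⟨hf.1, fun i hi => hf.2 (Finsupp.mem_support_iff.2 hi)⟩
  · intro f _ g _ h
    exact DFunLike.coe_injective h
  · intro g hg
    simp only [mem_piAntidiag] at hg
    refine ⟨Finsupp.onFinset s g hg.2, ?_, rfl⟩
    simp only [mem_finsuppAntidiag]
    exact ⟨hg.1, Finsupp.support_onFinset_subset⟩

lemma card_piAntidiag_univ_filter_apply_eq {α : Type*} [Fintype α] [DecidableEq α] (a : α)
    {N k : ℕ} (hk : k ≤ N) :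
    #{g ∈ piAntidiag (univ : Finset α) N | g a = k} =
      #(piAntidiag ((univ : Finset α).erase a) (N - k)) := by
  refine card_bij' (fun g _ => Function.update g a 0) (fun g _ => Function.update g a k) ?_ ?_ ?_ ?_
  · intro g hg
    simp only [mem_filter, mem_piAntidiag, mem_univ, implies_true, and_true] at hg
    obtain ⟨hg, rfl⟩ := hg
    simp only [mem_piAntidiag, sum_update_of_notMem (notMem_erase a univ)]
    refine ⟨?_, fun i hi => ?_⟩
    · rw [← hg, ← add_sum_erase univ g (mem_univ a)]
      omega
    · refine mem_erase.2 ⟨?_, mem_univ i⟩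
      rintro rfl
      simp at hi
  · intro g hg
    simp only [mem_piAntidiag] at hg
    simp only [mem_filter, mem_piAntidiag, mem_univ, implies_true, and_true,
      Function.update_self]
    rw [← add_sum_erase univ _ (mem_univ a), sum_update_of_notMem (notMem_erase a univ), hg.1,
      Function.update_self]
    omega
  · intro g hg
    simp only [mem_filter] at hg
    simp [← hg.2]
  · intro g hg
    simp only [mem_piAntidiag] at hg
    have : g a = 0 := by
      by_contra h
      exact notMem_erase a univ (hg.2 a h)
    simp [← this]

/-- For `1 ≤ k ≤ n`, the total number of blocks of size `k` counted over all noncrossing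
partitions of `{1,…,n}` equals the binomial coefficient `C(2n-k-1, n-1)`. -/
theorem sum_card_blocks_of_size_in_noncrossing_partitions (n k : ℕ) (hk : 1 ≤ k) (hkn : k ≤ n) :
    (∑ π ∈ (univ : Finset (Finpartition (univ : Finset (Fin n)))).filter IsNoncrossing,
      (π.parts.filter fun p => p.card = k).card) =
    Nat.choose (2 * n - k - 1) (n - 1) := by
  rw [sum_noncrossing_eq_sum_lukasiewicz n k hk, sum_lukasiewicz_eq_card hk,
    card_piAntidiag_univ_filter_apply_eq 0 hkn, card_piAntidiag_nat,
    card_erase_of_mem (mem_univ _), card_univ, ZMod.card, Nat.add_sub_cancel, show n + (n - k) - 1 = 2 * n - k - 1 by omega]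
  exact Nat.choose_symm_of_eq_add (by omega)
end

section
/- For every n ≥ 1, the number of pairs (π, π′) ∈ NC(n)² with π ∧ π′ = 0_n equals the number of pairs (π, π′) ∈ NC(n)² whose join in NC(n) equals 1_n. -/
open Finset
open scoped Classical

namespace Finpartition

section Part

variable {α : Type*} [DecidableEq α] [Fintype α] {π σ : Finpartition (univ : Finset α)}

lemma le_iff_part_eq_part : π ≤ σ ↔ ∀ a b, π.part a = π.part b → σ.part a = σ.part b := by
  constructor
  · intro h a b hab
    obtain ⟨q, hq, hsub⟩ := h (π.part_mem.2 (mem_univ a))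
    have ha : a ∈ q := hsub (π.mem_part (mem_univ a))
    have hb : b ∈ q := hsub (hab ▸ π.mem_part (mem_univ b))
    rw [σ.part_eq_of_mem hq ha, σ.part_eq_of_mem hq hb]
  · intro h p hp
    obtain ⟨a, ha⟩ := π.nonempty_of_mem_parts hp
    refine ⟨σ.part a, σ.part_mem.2 (mem_univ a), fun b hb ↦ ?_⟩
    rw [σ.mem_part_iff_part_eq_part (mem_univ b) (mem_univ a)]
    exact h b a ((π.part_eq_of_mem hp hb).trans (π.part_eq_of_mem hp ha).symm)

lemma part_inf_eq_part_inf_iff {a b : α} :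
    (π ⊓ σ).part a = (π ⊓ σ).part b ↔ π.part a = π.part b ∧ σ.part a = σ.part b := by
  refine ⟨fun h ↦ ⟨le_iff_part_eq_part.1 inf_le_left a b h,
    le_iff_part_eq_part.1 inf_le_right a b h⟩, fun ⟨h₁, h₂⟩ ↦ ?_⟩
  have ha₁ := π.mem_part (mem_univ a)
  have ha₂ := σ.mem_part (mem_univ a)
  have hb₁ : b ∈ π.part a := h₁ ▸ π.mem_part (mem_univ b)
  have hb₂ : b ∈ σ.part a := h₂ ▸ σ.mem_part (mem_univ b)
  have hp : π.part a ∩ σ.part a ∈ (π ⊓ σ).parts := by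
    rw [parts_inf, mem_erase]
    exact ⟨Finset.Nonempty.ne_empty ⟨a, mem_inter.2 ⟨ha₁, ha₂⟩⟩, mem_image.2
      ⟨(π.part a, σ.part a), by simp, rfl⟩⟩
  rw [part_eq_of_mem _ hp (mem_inter.2 ⟨ha₁, ha₂⟩), part_eq_of_mem _ hp (mem_inter.2 ⟨hb₁, hb₂⟩)]

lemma eq_of_part_bot_eq_part_bot {a b : α}
    (h : (⊥ : Finpartition (univ : Finset α)).part a = (⊥ : Finpartition univ).part b) :
    a = b := by
  have hp (c : α) : {c} ∈ (⊥ : Finpartition (univ : Finset α)).parts := by simp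
  rwa [part_eq_of_mem _ (hp a) (mem_singleton_self a),
    part_eq_of_mem _ (hp b) (mem_singleton_self b), singleton_inj] at h

lemma parts_eq_singleton_univ_iff [Nonempty α] :
    π.parts = {univ} ↔ ∀ a b, π.part a = π.part b := by
  constructor
  · intro h a b
    have hu : univ ∈ π.parts := by simp [h]
    rw [π.part_eq_of_mem hu (mem_univ a), π.part_eq_of_mem hu (mem_univ b)]
  · intro h
    have key (a : α) : π.part a = univ :=
      eq_univ_of_forall fun b ↦
        (π.mem_part_iff_part_eq_part (mem_univ b) (mem_univ a)).2 (h b a)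
    refine eq_singleton_iff_unique_mem.2 ⟨?_, fun p hp ↦ ?_⟩
    · obtain ⟨a⟩ := ‹Nonempty α›
      have ha := π.part_mem.2 (mem_univ a)
      rwa [key] at ha
    · obtain ⟨a, ha⟩ := π.nonempty_of_mem_parts hp
      rw [← π.part_eq_of_mem hp ha, key]

end Part

end Finpartition

open Finpartition

section Kreweras

variable {n : ℕ} {π σ : Finpartition (univ : Finset (Fin n))}

lemma isNoncrossing_iff_part : IsNoncrossing π ↔ ∀ i j k l, i < j → j < k → k < l →
    π.part i = π.part k → π.part j = π.part l → π.part i = π.part j := by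
  constructor
  · intro h i j k l hij hjk hkl hik hjl
    exact h _ (π.part_mem.2 (mem_univ i)) _ (π.part_mem.2 (mem_univ j)) i j k l hij hjk hkl
      (π.mem_part (mem_univ i)) (hik ▸ π.mem_part (mem_univ k))
      (π.mem_part (mem_univ j)) (hjl ▸ π.mem_part (mem_univ l))
  · intro h p hp q hq i j k l hij hjk hkl hi hk hj hl
    rw [← π.part_eq_of_mem hp hi, ← π.part_eq_of_mem hq hj]
    exact h i j k l hij hjk hkl
      ((π.part_eq_of_mem hp hi).trans (π.part_eq_of_mem hp hk).symm)
      ((π.part_eq_of_mem hq hj).trans (π.part_eq_of_mem hq hl).symm)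

lemma IsNoncrossing.inf_s7 (hπ : IsNoncrossing π) (hσ : IsNoncrossing σ) :
    IsNoncrossing (π ⊓ σ) := by
  rw [isNoncrossing_iff_part] at *
  simp only [part_inf_eq_part_inf_iff]
  intro i j k l hij hjk hkl hik hjl
  exact ⟨hπ i j k l hij hjk hkl hik.1 hjl.1, hσ i j k l hij hjk hkl hik.2 hjl.2⟩

lemma isNoncrossing_bot : IsNoncrossing (⊥ : Finpartition (univ : Finset (Fin n))) := by
  rw [isNoncrossing_iff_part]
  intro i j k l hij hjk _ hik _
  exact absurd (eq_of_part_bot_eq_part_bot hik) (hij.trans hjk).ne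

/-- Two indices `i < j` are related when the interval `(i, j]` is a union of blocks of `π`. -/
def krewerasSetoid (π : Finpartition (univ : Finset (Fin n))) : Setoid (Fin n) where
  r i j := ∀ u v, π.part u = π.part v → ((u ≤ i ↔ u ≤ j) ↔ (v ≤ i ↔ v ≤ j))
  iseqv :=
    { refl := fun _ _ _ _ ↦ by simp
      symm := fun h u v huv ↦ by have := h u v huv; tauto
      trans := fun h₁ h₂ u v huv ↦ by
        have := h₁ u v huv
        have := h₂ u v huv
        tauto }

/-- The Kreweras complement of a partition of `Fin n`. -/
noncomputable def kreweras (π : Finpartition (univ : Finset (Fin n))) :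
    Finpartition (univ : Finset (Fin n)) :=
  ofSetoid (krewerasSetoid π)

lemma part_kreweras_eq_iff {i j : Fin n} : (kreweras π).part i = (kreweras π).part j ↔
    ∀ u v, π.part u = π.part v → ((u ≤ i ↔ u ≤ j) ↔ (v ≤ i ↔ v ≤ j)) := by
  rw [eq_comm, ← mem_part_iff_part_eq_part _ (mem_univ j) (mem_univ i), kreweras,
    mem_part_ofSetoid_iff_rel]
  rfl

lemma kreweras_anti (h : π ≤ σ) : kreweras σ ≤ kreweras π := by
  rw [le_iff_part_eq_part] at *
  intro i j hij
  rw [part_kreweras_eq_iff] at *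
  exact fun u v huv ↦ hij u v (h u v huv)

lemma isNoncrossing_kreweras : IsNoncrossing (kreweras π) := by
  rw [isNoncrossing_iff_part]
  intro i j k l hij hjk hkl hik hjl
  have hjk' : (kreweras π).part j = (kreweras π).part k := by
    rw [part_kreweras_eq_iff] at *
    intro u v huv
    have h₁ := hik u v huv
    have h₂ := hjl u v huv
    grind
  exact hik.trans hjk'.symm

/-- Distinct blocks of a noncrossing partition are separated by an interval
which is a union of blocks. -/
lemma IsNoncrossing.exists_part_kreweras_eq (hπ : IsNoncrossing π) {x y : Fin n}
    (hxy : π.part x ≠ π.part y) : ∃ i j, (kreweras π).part i = (kreweras π).part j ∧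
      ¬((x ≤ i ↔ x ≤ j) ↔ (y ≤ i ↔ y ≤ j)) := by
  rw [isNoncrossing_iff_part] at hπ
  simp only [part_kreweras_eq_iff]
  have hne : (π.part x).Nonempty := by simp
  have mem_iff (z : Fin n) : z ∈ π.part x ↔ π.part z = π.part x :=
    π.mem_part_iff_part_eq_part (mem_univ z) (mem_univ x)
  by_cases hy : (∃ a, π.part a = π.part x ∧ a < y) ∧ ∃ b, π.part b = π.part x ∧ y < b
  · obtain ⟨⟨a₀, ha₀⟩, b₀, hb₀⟩ := hy
    obtain ⟨a, ⟨ha, hay⟩, hamax⟩ := Set.exists_max_image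
      {a | π.part a = π.part x ∧ a < y} id (Set.toFinite _) ⟨a₀, ha₀⟩
    obtain ⟨b, ⟨hb, hyb⟩, hbmin⟩ := Set.exists_min_image
      {b | π.part b = π.part x ∧ y < b} id (Set.toFinite _) ⟨b₀, hb₀⟩
    simp only [Set.mem_ofPred_eq, id] at hamax hbmin
    obtain ⟨c, hc⟩ : ∃ c : Fin n, ∀ z, z ≤ c ↔ z < b :=
      ⟨⟨b - 1, by omega⟩, fun z ↦ by simp only [Fin.le_def, Fin.lt_def] at *; omega⟩
    have gap (z : Fin n) (hz : π.part z = π.part x) : z ≤ a ∨ b ≤ z := by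
      rcases lt_trichotomy z y with h | rfl | h
      · exact Or.inl (hamax z ⟨hz, h⟩)
      · exact absurd hz.symm hxy
      · exact Or.inr (hbmin z ⟨hz, h⟩)
    have closed (u v : Fin n) (huv : π.part u = π.part v) (hau : a < u) (hub : u < b) :
        a < v ∧ v < b := by
      have hux : π.part u ≠ π.part x := fun h ↦ by have := gap u h; grind
      have h₁ := hπ v a u b
      have h₂ := hπ a u b v
      grind
    refine ⟨a, c, fun u v huv ↦ ?_, ?_⟩
    · have h₁ := closed u v huv
      have h₂ := closed v u huv.symm
      simp only [hc]
      grind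
    · have := gap x rfl
      simp only [hc]
      grind
  · set m := (π.part x).min' hne
    set M := (π.part x).max' hne
    have hm : π.part m = π.part x := (mem_iff m).1 (min'_mem _ _)
    have hM : π.part M = π.part x := (mem_iff M).1 (max'_mem _ _)
    have hull (z : Fin n) (hz : π.part z = π.part x) : m ≤ z ∧ z ≤ M :=
      ⟨min'_le _ _ ((mem_iff z).2 hz), le_max' _ _ ((mem_iff z).2 hz)⟩
    have hym : y < m ∨ M < y := by grind
    have closed (u v : Fin n) (huv : π.part u = π.part v) (hmu : m ≤ u) (huM : u ≤ M) :
        m ≤ v ∧ v ≤ M := by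
      have h₁ := hπ v m u M
      have h₂ := hπ m u M v
      have h₃ := hull v
      grind
    have hx := hull x rfl
    by_cases h0 : m.val = 0
    · refine ⟨⟨n - 1, by omega⟩, M, fun u v huv ↦ ?_, ?_⟩
      · have h₁ := closed u v huv
        have h₂ := closed v u huv.symm
        simp only [Fin.le_def, Fin.lt_def] at *
        omega
      · simp only [Fin.le_def, Fin.lt_def] at *
        omega
    · refine ⟨⟨m - 1, by omega⟩, M, fun u v huv ↦ ?_, ?_⟩
      · have h₁ := closed u v huv
        have h₂ := closed v u huv.symm
        simp only [Fin.le_def, Fin.lt_def] at *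
        omega
      · simp only [Fin.le_def, Fin.lt_def] at *
        omega

lemma le_of_kreweras_le_kreweras (hσ : IsNoncrossing σ) (h : kreweras σ ≤ kreweras π) :
    π ≤ σ := by
  rw [le_iff_part_eq_part] at *
  intro x y hxy
  by_contra hne
  obtain ⟨i, j, hij, hsep⟩ := hσ.exists_part_kreweras_eq hne
  exact hsep (part_kreweras_eq_iff.1 (h i j hij) x y hxy)

lemma kreweras_injOn :
    Set.InjOn kreweras {π : Finpartition (univ : Finset (Fin n)) | IsNoncrossing π} :=
  fun _ hπ _ hσ h ↦ le_antisymm (le_of_kreweras_le_kreweras hσ h.ge)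
    (le_of_kreweras_le_kreweras hπ h.le)

lemma IsNoncrossing.exists_kreweras_eq (hσ : IsNoncrossing σ) :
    ∃ π, IsNoncrossing π ∧ kreweras π = σ := by
  obtain ⟨⟨π, hπ⟩, h⟩ := Finite.surjective_of_injective
    (Set.MapsTo.restrict_inj (fun _ _ ↦ isNoncrossing_kreweras) |>.2 kreweras_injOn) ⟨σ, hσ⟩
  exact ⟨π, hπ, congrArg Subtype.val h⟩

lemma part_kreweras_bot (i j : Fin n) :
    (kreweras (⊥ : Finpartition (univ : Finset (Fin n)))).part i = (kreweras ⊥).part j :=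
  part_kreweras_eq_iff.2 fun u v huv ↦ by rw [eq_of_part_bot_eq_part_bot huv]

/-- Kreweras complementation exchanges trivial meets and trivial joins in `NC(n)`. -/
lemma inf_eq_bot_iff_kreweras [NeZero n] (hπ : IsNoncrossing π) (hσ : IsNoncrossing σ) :
    π ⊓ σ = ⊥ ↔ ∀ τ : Finpartition (univ : Finset (Fin n)), IsNoncrossing τ →
      kreweras π ≤ τ → kreweras σ ≤ τ → τ.parts = {univ} := by
  constructor
  · intro h τ hτ hπτ hστ
    obtain ⟨ρ, hρ, rfl⟩ := hτ.exists_kreweras_eq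
    have hbot : ρ = ⊥ := le_bot_iff.1 <| h ▸
      le_inf (le_of_kreweras_le_kreweras hπ hπτ) (le_of_kreweras_le_kreweras hσ hστ)
    rw [hbot, parts_eq_singleton_univ_iff]
    exact part_kreweras_bot
  · intro h
    have htop := h _ isNoncrossing_kreweras (kreweras_anti inf_le_left)
      (kreweras_anti (inf_le_right : π ⊓ σ ≤ σ))
    rw [parts_eq_singleton_univ_iff] at htop
    exact le_bot_iff.1 (le_of_kreweras_le_kreweras isNoncrossing_bot
      (le_iff_part_eq_part.2 fun a b _ ↦ htop a b))

end Kreweras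

/-- For every `n ≥ 1`, the number of pairs of noncrossing partitions of `{1,…,n}` whose meet
(common refinement) is the discrete partition `0ₙ` equals the number of pairs of noncrossing
partitions whose join in the lattice `NC(n)` is the one-block partition `1ₙ` (i.e. such that
the only noncrossing partition coarser than both is `1ₙ`). -/
theorem card_pairs_meet_bot_eq_card_pairs_join_top (n : ℕ) (hn : 1 ≤ n) :
    (((univ : Finset (Finpartition (univ : Finset (Fin n)) ×
        Finpartition (univ : Finset (Fin n)))).filter
      (fun x => IsNoncrossing x.1 ∧ IsNoncrossing x.2 ∧ x.1 ⊓ x.2 = ⊥)).card) =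
    (((univ : Finset (Finpartition (univ : Finset (Fin n)) ×
        Finpartition (univ : Finset (Fin n)))).filter
      (fun x => IsNoncrossing x.1 ∧ IsNoncrossing x.2 ∧
        ∀ σ : Finpartition (univ : Finset (Fin n)), IsNoncrossing σ →
          x.1 ≤ σ → x.2 ≤ σ → σ.parts = {(univ : Finset (Fin n))})).card) := by
  have : NeZero n := ⟨by omega⟩
  refine card_bij (fun x _ ↦ (kreweras x.1, kreweras x.2)) ?_ ?_ ?_
  · simp only [mem_filter, mem_univ, true_and]
    rintro ⟨π, σ⟩ ⟨hπ, hσ, h⟩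
    exact ⟨isNoncrossing_kreweras, isNoncrossing_kreweras, (inf_eq_bot_iff_kreweras hπ hσ).1 h⟩
  · simp only [mem_filter, mem_univ, true_and, Prod.mk.injEq]
    rintro ⟨π, σ⟩ ⟨hπ, hσ, _⟩ ⟨π', σ'⟩ ⟨hπ', hσ', _⟩ ⟨h₁, h₂⟩
    exact Prod.ext (kreweras_injOn hπ hπ' h₁) (kreweras_injOn hσ hσ' h₂)
  · simp only [mem_filter, mem_univ, true_and]
    rintro ⟨π', σ'⟩ ⟨hπ', hσ', h⟩
    obtain ⟨π, hπ, rfl⟩ := hπ'.exists_kreweras_eq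
    obtain ⟨σ, hσ, rfl⟩ := hσ'.exists_kreweras_eq
    exact ⟨(π, σ), ⟨hπ, hσ, (inf_eq_bot_iff_kreweras hπ hσ).2 h⟩, rfl⟩
end

section
/- Let A be a commutative ring. For every sequence (M_m)_{m≥1} of elements of A there exists a unique sequence (R_m)_{m≥1} of elements of A such that M_n = Σ_{π ∈ NC(n)} R_π holds for all n ≥ 1 (the free cumulant sequence of the moment sequence (M_m)). -/
open Finset
open scoped Classical

theorem Finpartition.eq_indiscrete_of_mem {α : Type*} [Lattice α] [OrderBot α] {a : α}
    (ha : a ≠ ⊥) (π : Finpartition a) (h : a ∈ π.parts) : π = Finpartition.indiscrete ha := by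
  refine Finpartition.ext (Finset.ext fun q => ?_)
  rw [Finpartition.indiscrete_parts, Finset.mem_singleton]
  refine ⟨fun hq => ?_, fun hq => hq ▸ h⟩
  by_contra hne
  exact π.ne_bot hq ((π.disjoint hq h hne).eq_bot_of_le (π.le hq))

theorem isNoncrossing_indiscrete {n : ℕ} (hn : (univ : Finset (Fin n)) ≠ ⊥) :
    IsNoncrossing (Finpartition.indiscrete hn) := by
  intro p hp q hq
  rw [Finpartition.indiscrete_parts, Finset.mem_singleton] at hp hq
  intros
  rw [hp, hq]

/-- The contribution to the moment-cumulant formula of the noncrossing partitions of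
`{1,…,n}` other than the one-block partition. -/
noncomputable def properNoncrossingSum {A : Type*} [CommRing A] (R : ℕ → A) (n : ℕ) : A :=
  ∑ π ∈ (univ : Finset (Finpartition (univ : Finset (Fin n)))).filter
    (fun π => IsNoncrossing π ∧ univ ∉ π.parts), ∏ p ∈ π.parts, R p.card

theorem noncrossingSum_eq_add {A : Type*} [CommRing A] (R : ℕ → A) {n : ℕ} (hn : 1 ≤ n) :
    ∑ π ∈ (univ : Finset (Finpartition (univ : Finset (Fin n)))).filter IsNoncrossing,
      ∏ p ∈ π.parts, R p.card = R n + properNoncrossingSum R n := by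
  have : NeZero n := ⟨by omega⟩
  have hne : (univ : Finset (Fin n)) ≠ ⊥ := Finset.univ_nonempty.ne_empty
  rw [← Finset.add_sum_erase _ _ (Finset.mem_filter.2
    ⟨Finset.mem_univ _, isNoncrossing_indiscrete hne⟩)]
  congr 1
  · simp
  · refine Finset.sum_congr (Finset.ext fun π => ?_) fun _ _ => rfl
    simp only [Finset.mem_erase, Finset.mem_filter, Finset.mem_univ, true_and]
    refine ⟨fun h => ⟨h.2, fun hu => h.1 (π.eq_indiscrete_of_mem hne hu)⟩,
      fun h => ⟨?_, h.1⟩⟩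
    rintro rfl
    simp at h

theorem properNoncrossingSum_congr {A : Type*} [CommRing A] {R R' : ℕ → A} {n : ℕ}
    (h : ∀ m, 1 ≤ m → m < n → R m = R' m) :
    properNoncrossingSum R n = properNoncrossingSum R' n := by
  refine Finset.sum_congr rfl fun π hπ => Finset.prod_congr rfl fun p hp => h _ ?_ ?_
  · exact Finset.card_pos.2 (π.nonempty_of_mem_parts hp)
  · have hlt : p ⊂ univ :=
      (Finset.subset_univ p).lt_of_ne fun hpu => (Finset.mem_filter.1 hπ).2.2 (hpu ▸ hp)
    simpa using Finset.card_lt_card hlt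

/-- The free cumulants of a moment sequence, by recursion on the triangular system. -/
noncomputable def freeCumulant {A : Type*} [CommRing A] (M : ℕ → A) (n : ℕ) : A :=
  M n - properNoncrossingSum (fun m => if _h : m < n then freeCumulant M m else 0) n
termination_by n

/-- **Existence and uniqueness of free cumulants.**  Over any commutative ring, every moment
sequence `(M_m)_{m ≥ 1}` admits a unique free cumulant sequence `(R_m)_{m ≥ 1}`, i.e. a
sequence satisfying `M_n = ∑_{π ∈ NC(n)} ∏_{p ∈ π} R_{|p|}` for all `n ≥ 1`. -/
theorem existsUnique_free_cumulant_sequence {A : Type*} [CommRing A] (M : ℕ → A) :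
    ∃ R : ℕ → A,
      (∀ n : ℕ, 1 ≤ n →
        M n = ∑ π ∈ (univ : Finset (Finpartition (univ : Finset (Fin n)))).filter IsNoncrossing,
          ∏ p ∈ π.parts, R p.card) ∧
      ∀ R' : ℕ → A,
        (∀ n : ℕ, 1 ≤ n →
          M n = ∑ π ∈ (univ : Finset (Finpartition (univ : Finset (Fin n)))).filter
            IsNoncrossing, ∏ p ∈ π.parts, R' p.card) →
        ∀ m : ℕ, 1 ≤ m → R m = R' m := by
  refine ⟨freeCumulant M, fun n hn => ?_, fun R' hR' m => ?_⟩
  · rw [noncrossingSum_eq_add _ hn, freeCumulant, sub_add_eq_add_sub, eq_sub_iff_add_eq]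
    congr 1
    exact properNoncrossingSum_congr fun m _ hm => dif_pos hm
  · induction m using Nat.strong_induction_on with
    | _ m ih =>
      intro hm
      rw [freeCumulant, hR' m hm, noncrossingSum_eq_add _ hm, sub_eq_iff_eq_add]
      congr 1
      refine properNoncrossingSum_congr fun k hk hkm => ?_
      rw [dif_pos hkm, ih k hkm hk]
end
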